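/- For every s ∈ {1,…,n}, the local cohomology module H^{s·(m−n)+1}_I(S) is nonzero, i.e., (localCohomology I (s·(m−n)+1)).obj (ModuleCat.of S S) is nontrivial. -/

import Mathlib

open MvPolynomial

noncomputable section

section LocalCohomology

open CategoryTheory Limits Opposite

universe u
section
variable {R : Type*} [Ring R] {C : Type*} [Category* C] [Abelian C] [Linear R C]
  [EnoughProjectives C]

/-- The cochain map induced on `Hom(-, Z)` by a chain map. -/
def linearYonedaMap (R : Type*) [Ring R] [Linear R C] {K L : ChainComplex C ℕ} (g : K ⟶ L) (Z : C) :
    L.linearYonedaObj R Z ⟶ K.linearYonedaObj R Z :=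
  (HomologicalComplex.unopFunctor _ _).map
    ((((linearYoneda R C).obj Z).rightOp.mapHomologicalComplex _).map g).op

lemma comp_eq_of_squares {D : Type*} [Category* D] {A B A' B' A'' B'' : D} {x : A ⟶ B}
    {a : B ⟶ B'} {b : A ⟶ A'} {y : A' ⟶ B'} {c : A'' ⟶ A'} {e : B'' ⟶ B'} {z : A'' ⟶ B''}
    {c' : A' ⟶ A''} {e' : B' ⟶ B''} (h : x ≫ a = b ≫ y) (h' : c ≫ y = z ≫ e)
    (hc : c' ≫ c = 𝟙 _) (he : e ≫ e' = 𝟙 _) : x ≫ a ≫ e' = (b ≫ c') ≫ z := by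
  have : y ≫ e' = c' ≫ z := by
    rw [← Category.comp_id z, ← he, ← reassoc_of% h', reassoc_of% hc]
  rw [reassoc_of% h, this, Category.assoc]

lemma isoExt_hom_naturality {X Y : C} (f : X ⟶ Y) (P : ProjectiveResolution X)
    (Q : ProjectiveResolution Y) (g : P.complex ⟶ Q.complex)
    (comm : g.f 0 ≫ Q.π.f 0 = P.π.f 0 ≫ f) (n : ℕ) (Z : C) :
    ((Ext R C n).map f.op).app Z ≫ (P.isoExt n Z).hom =
      (Q.isoExt n Z).hom ≫
        HomologicalComplex.homologyMap (linearYonedaMap R g Z) n := by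
  have h1 := ProjectiveResolution.isoLeftDerivedObj_inv_naturality f P Q g comm
    ((linearYoneda R C).obj Z).rightOp n
  have h2 := HomologicalComplex.homologyOp_hom_naturality (linearYonedaMap R g Z) n
  exact comp_eq_of_squares (congrArg Quiver.Hom.unop h1) (congrArg Quiver.Hom.unop h2)
    (congrArg Quiver.Hom.unop (Q.complex.linearYonedaObj R Z |>.homologyOp n).hom_inv_id)
    (congrArg Quiver.Hom.unop (P.complex.linearYonedaObj R Z |>.homologyOp n).inv_hom_id)
end

section
variable {R : Type u} [Ring R]

/-- A cocycle of a cochain complex of modules has a homology class, and if this class maps to zero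
under a cochain map then the image of the cocycle is a coboundary. -/
lemma exists_homology_class {K : CochainComplex (ModuleCat.{u} R) ℕ} (i : ℕ) (x : K.X (i + 1))
    (hx : (K.d (i + 1) (i + 2)).hom x = 0) :
    ∃ c : K.homology (i + 1), ∀ {L : CochainComplex (ModuleCat.{u} R) ℕ} (g : K ⟶ L),
      (HomologicalComplex.homologyMap g (i + 1)).hom c = 0 → 
        ∃ y : L.X i, (L.d i (i + 1)).hom y = (g.f (i + 1)).hom x := by
  let k : ModuleCat.of R R ⟶ K.X (i + 1) := ModuleCat.ofHom (LinearMap.toSpanSingleton R _ x)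
  have hk : k ≫ K.d (i + 1) (i + 2) = 0 := by
    ext
    simpa [k] using hx
  refine ⟨(K.liftCycles k (i + 2) (by simp) hk ≫ K.homologyπ (i + 1)).hom 1, fun {L} g hg => ?_⟩
  have h0 : L.liftCycles (k ≫ g.f (i + 1)) (i + 2) (by simp)
      (by rw [Category.assoc, g.comm, reassoc_of% hk, zero_comp]) ≫ L.homologyπ (i + 1) = 0 := by
    rw [← HomologicalComplex.liftCycles_comp_cyclesMap_assoc (k := k) (j := i + 2) (hj := by simp) (hk := hk) (φ := g), ← HomologicalComplex.homologyπ_naturality]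
    exact ModuleCat.hom_ext (LinearMap.ext_ring hg)
  rw [HomologicalComplex.liftCycles_comp_homologyπ_eq_zero_iff_up_to_refinements _ i (i + 1) (i + 2)
    (by simp) (by simp)] at h0
  obtain ⟨A', π, hπ, y, hy⟩ := h0
  obtain ⟨a, ha⟩ := (ModuleCat.epi_iff_surjective π).1 hπ (1 : R)
  refine ⟨y.hom a, ?_⟩
  have := congrArg (fun f => f.hom a) hy
  simp only [ModuleCat.hom_comp, LinearMap.comp_apply] at this
  rw [← this]
  erw [ha]
  simp [k]
end

section
variable {R : Type u} [CommRing R]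

/-- A cocycle on a projective resolution of `Y` determines an `Ext` class, and if this class dies
in `Ext` of `X`, then the cocycle becomes a coboundary on any projective resolution of `X`. -/
lemma exists_ext_class {Y Z : ModuleCat.{u} R} (Q : ProjectiveResolution Y) (n : ℕ)
    (φ : Q.complex.X (n + 1) ⟶ Z) (hφ : Q.complex.d (n + 2) (n + 1) ≫ φ = 0) :
    ∃ c : ((Ext R (ModuleCat.{u} R) (n + 1)).obj (op Y)).obj Z,
      ∀ {X : ModuleCat.{u} R} (f : X ⟶ Y) (P : ProjectiveResolution X)
        (g : P.complex ⟶ Q.complex) (_ : g.f 0 ≫ Q.π.f 0 = P.π.f 0 ≫ f),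
        (((Ext R (ModuleCat.{u} R) (n + 1)).map f.op).app Z).hom c = 0 →
          ∃ χ : P.complex.X n ⟶ Z, g.f (n + 1) ≫ φ = P.complex.d (n + 1) n ≫ χ := by
  obtain ⟨c, hc⟩ := exists_homology_class (K := Q.complex.linearYonedaObj R Z) n φ
    hφ
  refine ⟨(Q.isoExt (n + 1) Z).inv.hom c, fun {X} f P g comm h0 => ?_⟩
  obtain ⟨y, hy⟩ := hc (linearYonedaMap R g Z) (by
    have := congrArg (fun f => f.hom ((Q.isoExt (n + 1) Z).inv.hom c))
      (isoExt_hom_naturality f P Q g comm (n + 1) Z)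
    simp only [ModuleCat.hom_comp, LinearMap.comp_apply, h0, map_zero] at this
    rw [this]
    simp)
  exact ⟨y, hy.symm⟩
end

section
variable {C : Type*} [Category* C] [Abelian C] {N N' M : C}

lemma InjectiveResolution.exists_augmentation (E : InjectiveResolution M) :
    ∃ η : M ⟶ E.cocomplex.X 0, η ≫ E.cocomplex.d 0 1 = 0 ∧ Mono η ∧
      ∀ {A : C} (ζ : A ⟶ E.cocomplex.X 0), ζ ≫ E.cocomplex.d 0 1 = 0 →
        ∃ φ : A ⟶ M, φ ≫ η = ζ :=
  ⟨E.ι.f 0, E.ι_f_zero_comp_complex_d, inferInstanceAs (Mono (E.ι.f 0)), fun ζ h =>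
    ⟨(E.isLimitKernelFork).lift (KernelFork.ofι ζ h),
      (E.isLimitKernelFork).fac (KernelFork.ofι ζ h) WalkingParallelPair.zero⟩⟩

lemma ProjectiveResolution.exists_augmentation (Q : ProjectiveResolution N) :
    ∃ p : Q.complex.X 0 ⟶ N, p = Q.π.f 0 ∧ Q.complex.d 1 0 ≫ p = 0 ∧ Epi p ∧
      ∀ {A : C} (ζ : Q.complex.X 0 ⟶ A), Q.complex.d 1 0 ≫ ζ = 0 →
        ∃ φ : N ⟶ A, p ≫ φ = ζ :=
  ⟨Q.π.f 0, rfl, Q.complex_d_comp_π_f_zero, inferInstanceAs (Epi (Q.π.f 0)), fun ζ h =>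
    ⟨(Q.isColimitCokernelCofork).desc (CokernelCofork.ofπ ζ h),
      (Q.isColimitCokernelCofork).fac (CokernelCofork.ofπ ζ h) WalkingParallelPair.one⟩⟩

/-- Zigzag from a cochain `ζ` on `Q` with values in an injective resolution of `M` to a cochain
on `Q` with values in `M`, which reflects being a coboundary after restriction along `q`. -/
lemma exists_cocycle_of_bicocycle (Q : ProjectiveResolution N) 
    (E : InjectiveResolution M) (e k j : ℕ) (hj : k + e = j)
    (ζ : Q.complex.X (k + 1) ⟶ E.cocomplex.X e)
    (h1 : Q.complex.d (k + 2) (k + 1) ≫ ζ = 0) (h2 : ζ ≫ E.cocomplex.d e (e + 1) = 0) :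
    ∃ φ : Q.complex.X (j + 1) ⟶ M, Q.complex.d (j + 2) (j + 1) ≫ φ = 0 ∧ 
      ∀ {N' : C} (Q' : ProjectiveResolution N') (q : Q'.complex ⟶ Q.complex),
      ((∃ χ : Q'.complex.X j ⟶ M, q.f (j + 1) ≫ φ = Q'.complex.d (j + 1) j ≫ χ) →
        ∃ χ : Q'.complex.X k ⟶ E.cocomplex.X e, q.f (k + 1) ≫ ζ = Q'.complex.d (k + 1) k ≫ χ ∧
          χ ≫ E.cocomplex.d e (e + 1) = 0) := by
  induction e generalizing k with
  | zero =>
    obtain rfl : k = j := hj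
    obtain ⟨η, hη, hm, hl⟩ := InjectiveResolution.exists_augmentation E
    obtain ⟨φ, hφ⟩ := hl ζ h2
    refine ⟨φ, ?_, ?_⟩
    · rw [← cancel_mono η, Category.assoc, hφ, h1, zero_comp]
    · rintro N' Q' q ⟨χ, hχ⟩
      exact ⟨χ ≫ η, by rw [← reassoc_of% hχ, hφ], by rw [Category.assoc, hη, comp_zero]⟩
  | succ e ih =>
    have hE := E.exact_succ e
    let ψ : Q.complex.X (k + 1) ⟶ E.cocomplex.X e := hE.liftFromProjective ζ h2
    have hψ : ψ ≫ E.cocomplex.d e (e + 1) = ζ := hE.liftFromProjective_comp ζ h2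
    obtain ⟨φ, hφ, H⟩ := ih (k + 1) (by omega) (Q.complex.d (k + 2) (k + 1) ≫ ψ) (by simp) 
      (by rw [Category.assoc, hψ, h1])
    refine ⟨φ, hφ, fun {N'} Q' q h => ?_⟩
    obtain ⟨χ, hχ, hχ'⟩ := H Q' q h
    have hz : Q'.complex.d (k + 2) (k + 1) ≫ (q.f (k + 1) ≫ ψ - χ) = 0 := by
      rw [Preadditive.comp_sub, ← q.comm_assoc, ← hχ]
      exact sub_self _
    have hQ := Q'.exact_succ k
    let χ' : Q'.complex.X k ⟶ E.cocomplex.X e := hQ.descToInjective _ hz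
    have hχ'' : Q'.complex.d (k + 1) k ≫ χ' = q.f (k + 1) ≫ ψ - χ := hQ.comp_descToInjective _ hz
    refine ⟨χ' ≫ E.cocomplex.d e (e + 1), ?_, by simp⟩
    rw [reassoc_of% hχ'', Preadditive.sub_comp, hχ', Category.assoc, hψ, sub_zero]

/-- A cocycle in `Hom(N, E^(n+1))` yields a cocycle on a projective resolution of `N` with
values in `E^n`, which reflects being a coboundary after restriction along `f : N' ⟶ N`. -/
lemma exists_cocycle_of_hom (Q : ProjectiveResolution N) (E : InjectiveResolution M) (n : ℕ)
    (x : N ⟶ E.cocomplex.X (n + 1)) (hx : x ≫ E.cocomplex.d (n + 1) (n + 2) = 0)  :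
    ∃ ζ : Q.complex.X 1 ⟶ E.cocomplex.X n, Q.complex.d 2 1 ≫ ζ = 0 ∧ 
      ζ ≫ E.cocomplex.d n (n + 1) = 0 ∧
      ∀ {N' : C} (Q' : ProjectiveResolution N') (f : N' ⟶ N) (q : Q'.complex ⟶ Q.complex) 
        (_ : q.f 0 ≫ Q.π.f 0 = Q'.π.f 0 ≫ f),
      (∃ χ : Q'.complex.X 0 ⟶ E.cocomplex.X n, q.f 1 ≫ ζ = Q'.complex.d 1 0 ≫ χ ∧
          χ ≫ E.cocomplex.d n (n + 1) = 0) →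
        ∃ y : N' ⟶ E.cocomplex.X n, y ≫ E.cocomplex.d n (n + 1) = f ≫ x := by
  obtain ⟨p, hpQ, hp, -, -⟩ := ProjectiveResolution.exists_augmentation Q
  have hE := E.exact_succ n
  have hz : (p ≫ x) ≫ E.cocomplex.d (n + 1) (n + 2) = 0 := by simp [hx]
  let ψ : Q.complex.X 0 ⟶ E.cocomplex.X n := hE.liftFromProjective _ hz
  have hψ : ψ ≫ E.cocomplex.d n (n + 1) = p ≫ x := hE.liftFromProjective_comp _ hz
  refine ⟨Q.complex.d 1 0 ≫ ψ, by simp, ?_, ?_⟩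
  · rw [Category.assoc, hψ, reassoc_of% hp, zero_comp]
  · rintro N' Q' f q hq ⟨χ, hχ, hχ'⟩
    have hz : Q'.complex.d 1 0 ≫ (q.f 0 ≫ ψ - χ) = 0 := by
      rw [Preadditive.comp_sub, ← q.comm_assoc, ← hχ, sub_self]
    obtain ⟨p', hpQ', -, hepi, hdesc⟩ := ProjectiveResolution.exists_augmentation Q'
    obtain ⟨y, hy⟩ := hdesc _ hz
    have hq' : q.f 0 ≫ p = p' ≫ f := by
      rw [hpQ, hpQ']; exact hq
    refine ⟨y, ?_⟩
    rw [← cancel_epi p', reassoc_of% hy, Preadditive.sub_comp, hχ', Category.assoc, hψ, sub_zero,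
      reassoc_of% hq']
end

section
variable {R : Type u} [CommRing R]

lemma exists_ext_class_of_hom {N M : ModuleCat.{u} R} (E : InjectiveResolution M) (n : ℕ)
    (x : N ⟶ E.cocomplex.X (n + 1)) (hx : x ≫ E.cocomplex.d (n + 1) (n + 2) = 0) :
    ∃ c : ((Ext R (ModuleCat.{u} R) (n + 1)).obj (op N)).obj M,
      ∀ {N' : ModuleCat.{u} R} (f : N' ⟶ N),
        (((Ext R (ModuleCat.{u} R) (n + 1)).map f.op).app M).hom c = 0 →
          ∃ y : N' ⟶ E.cocomplex.X n, y ≫ E.cocomplex.d n (n + 1) = f ≫ x := by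
  let Q := projectiveResolution N
  obtain ⟨ζ, h1, h2, H⟩ := exists_cocycle_of_hom Q E n x hx
  obtain ⟨φ, hφ, H'⟩ := exists_cocycle_of_bicocycle Q E n 0 n (by omega) ζ h1 h2
  obtain ⟨c, hc⟩ := exists_ext_class Q n φ hφ
  refine ⟨c, fun {N'} f hf => ?_⟩
  let Q' := projectiveResolution N'
  let q := ProjectiveResolution.lift f Q' Q
  have hq : q.f 0 ≫ Q.π.f 0 = Q'.π.f 0 ≫ f := ProjectiveResolution.lift_commutes_zero f Q' Q
  exact H Q' f q hq (H' Q' q (hc f Q' q hq hf))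

end

section
variable {R : Type} [CommRing R]

/-- If local cohomology with support in `J` vanishes in degree `n + 1`, then each `J`-torsion
cocycle of degree `n + 1` in an injective resolution is the coboundary of a `J`-torsion element. -/
lemma exists_torsion_primitive (J : Ideal R) (n : ℕ) (M : ModuleCat.{0} R)
    (h : Subsingleton ((localCohomology J (n + 1)).obj M)) (E : InjectiveResolution M)
    (x : E.cocomplex.X (n + 1)) (hx : (E.cocomplex.d (n + 1) (n + 2)).hom x = 0) (t : ℕ)
    (ht : ∀ r ∈ J ^ t, r • x = 0) :
    ∃ z : E.cocomplex.X n, (E.cocomplex.d n (n + 1)).hom z = x ∧ 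
      ∃ t', ∀ r ∈ J ^ t', r • z = 0 := by
  let F := localCohomology.diagram (localCohomology.idealPowersDiagram J) (n + 1)
  let x' : (localCohomology.ringModIdeals (localCohomology.idealPowersDiagram J)).obj (op t) ⟶
    E.cocomplex.X (n + 1) :=
    ModuleCat.ofHom ((J ^ t).liftQ (LinearMap.toSpanSingleton R _ x) (fun r hr => ht r hr))
  have hx' : x' ≫ E.cocomplex.d (n + 1) (n + 2) = 0 := by
    refine ModuleCat.hom_ext (Submodule.linearMap_qext _ (LinearMap.ext_ring ?_))
    change (E.cocomplex.d (n + 1) (n + 2)).hom ((1 : R) • x) = 0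
    rw [one_smul, hx]
  obtain ⟨c, hc⟩ := exists_ext_class_of_hom E n x' hx'
  let e : (localCohomology J (n + 1)).obj M ≅ colimit (F ⋙ (evaluation _ _).obj M) :=
    colimitObjIsoColimitCompEvaluation F M
  have hz : (colimit.ι (F ⋙ (evaluation _ _).obj M) (op (op t))).hom c = 0 := by
    have : Function.Injective e.inv.hom :=
      (ModuleCat.mono_iff_injective e.inv).1 inferInstance
    exact this (Subsingleton.elim _ _)
  obtain ⟨j, i, hi⟩ := Concrete.colimit_rep_eq_zero (F := F ⋙ (evaluation _ _).obj M) (x := c) (hx := hz)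
  obtain ⟨y, hy⟩ := hc _ hi
  let one : (localCohomology.ringModIdeals (localCohomology.idealPowersDiagram J)).obj j.unop :=
    (Submodule.mkQ (J ^ j.unop.unop) : R →ₗ[R] R ⧸ (J ^ j.unop.unop)) 1
  refine ⟨y.hom one, ?_, j.unop.unop, fun r hr => ?_⟩
  · have := congrArg (fun f => f.hom one) hy
    refine Eq.trans this ?_
    change (1 : R) • x = x
    rw [one_smul]
  · rw [← map_smul]
    have : r • one = 0 := by
      change r • (Submodule.Quotient.mk (1 : R) : R ⧸ (J ^ j.unop.unop)) = 0
      rw [← Submodule.Quotient.mk_smul, Submodule.Quotient.mk_eq_zero]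
      simpa using hr
    rw [this, map_zero]
end

section
variable {R : Type} [CommRing R] {M : Type} [AddCommGroup M] [Module R M]

/-- The submodule of elements which are torsion with respect to each of `θ 0, …, θ (k - 1)`. -/
def jointTorsion (θ : ℕ → R) (k : ℕ) (M : Type) [AddCommGroup M] [Module R M] : Submodule R M where
  carrier := {x | ∀ j < k, ∃ t : ℕ, θ j ^ t • x = 0}
  zero_mem' := fun _ _ => ⟨0, smul_zero _⟩
  add_mem' := by
    intro x y hx hy j hj
    obtain ⟨a, ha⟩ := hx j hj
    obtain ⟨b, hb⟩ := hy j hj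
    refine ⟨a + b, ?_⟩
    rw [smul_add, pow_add, mul_smul, smul_comm, ha, smul_zero, mul_smul, hb, smul_zero, add_zero]
  smul_mem' := by
    intro r x hx j hj
    obtain ⟨a, ha⟩ := hx j hj
    exact ⟨a, by rw [smul_comm, ha, smul_zero]⟩

lemma mem_jointTorsion {θ : ℕ → R} {k : ℕ} {x : M} :
    x ∈ jointTorsion θ k M ↔ ∀ j < k, ∃ t : ℕ, θ j ^ t • x = 0 := Iff.rfl

lemma jointTorsion_succ {θ : ℕ → R} {k : ℕ} {x : M} :
    x ∈ jointTorsion θ (k + 1) M ↔ x ∈ jointTorsion θ k M ∧ ∃ t : ℕ, θ k ^ t • x = 0 := by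
  rw [mem_jointTorsion, mem_jointTorsion, Nat.forall_lt_succ_right]

lemma map_mem_jointTorsion {θ : ℕ → R} {k : ℕ} {x : M} {N : Type} [AddCommGroup N] [Module R N]
    (f : M →ₗ[R] N) (hx : x ∈ jointTorsion θ k M) : f x ∈ jointTorsion θ k N := fun j hj => by
  obtain ⟨t, ht⟩ := hx j hj
  exact ⟨t, by rw [← map_smul, ht, map_zero]⟩

lemma exists_span_pow_smul_eq_zero [IsNoetherianRing R] {θ : ℕ → R} {k : ℕ} {x : M}
    (hx : x ∈ jointTorsion θ k M) :
    ∃ u : ℕ, ∀ r ∈ Ideal.span (θ '' Set.Iio k) ^ u, r • x = 0 := by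
  let A : Ideal R := LinearMap.ker (LinearMap.toSpanSingleton R M x)
  have h : Ideal.span (θ '' Set.Iio k) ≤ A.radical := by
    rw [Ideal.span_le]
    rintro _ ⟨j, hj, rfl⟩
    obtain ⟨t, ht⟩ := hx j hj
    exact ⟨t, by simpa [A] using ht⟩
  obtain ⟨u, hu⟩ := Ideal.exists_pow_le_of_le_radical_of_fg h (IsNoetherian.noetherian _)
  exact ⟨u, fun r hr => by simpa [A] using hu hr⟩

/-- In an injective module over a Noetherian ring, torsion elements are divisible by powers of `f`,
up to multiplication by some power of `f`, within the torsion submodule. -/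
lemma exists_pow_smul_eq_pow_smul [IsNoetherianRing R] (hM : Module.Injective R M) {θ : ℕ → R}
    {k : ℕ} {x : M} (hx : x ∈ jointTorsion θ k M) (f : R) (t : ℕ) :
    ∃ a : ℕ, ∃ y ∈ jointTorsion θ k M, f ^ (a + t) • y = f ^ a • x := by
  obtain ⟨u, hu⟩ := exists_span_pow_smul_eq_zero hx
  set J := Ideal.span (θ '' Set.Iio k)
  obtain ⟨a, ha⟩ : ∃ a, ∀ r : R, f ^ (a + t) * r = 0 → f ^ a * r = 0 := by
    obtain ⟨a, ha⟩ := monotone_stabilizes_iff_noetherian.mpr (inferInstanceAs (IsNoetherian R R))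
      (LinearMap.iterateKer (LinearMap.mulLeft R f))
    refine ⟨a, fun r hr => ?_⟩
    have h := ha (a + t) (by omega)
    have key : ∀ n : ℕ, r ∈ LinearMap.iterateKer (LinearMap.mulLeft R f) n ↔ f ^ n * r = 0 := by
      intro n
      rw [LinearMap.iterateKer_coe, LinearMap.mem_ker, LinearMap.pow_mulLeft,
        LinearMap.mulLeft_apply]
    rw [← key, h, key]
    exact hr
  set g := f ^ (a + t)
  obtain ⟨c, hc⟩ := Ideal.exists_pow_inf_eq_pow_smul (M := R) J (Ideal.span {g})
  have hAR : ∀ r : R, g * r ∈ J ^ (u + c) → ∃ j ∈ J ^ u, g * r = g * j := by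
    intro r hr
    have h1 : g * r ∈ J ^ (u + c) • (⊤ : Ideal R) ⊓ Ideal.span {g} :=
      ⟨by simpa using hr, Ideal.mem_span_singleton.2 (dvd_mul_right _ _)⟩
    rw [hc (u + c) (by omega), Nat.add_sub_cancel] at h1
    have h2 : g * r ∈ J ^ u • Ideal.span {g} := Submodule.smul_mono le_rfl inf_le_right h1
    rw [smul_eq_mul, Ideal.mem_mul_span_singleton] at h2
    obtain ⟨j, hj, h⟩ := h2
    exact ⟨j, hj, by rw [← h, mul_comm]⟩
  let ℓ : R →ₗ[R] R ⧸ J ^ (u + c) := (J ^ (u + c)).mkQ ∘ₗ LinearMap.mulLeft R g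
  have hℓ : ∀ r, ℓ r = (J ^ (u + c)).mkQ (g * r) := fun r => rfl
  have hker : LinearMap.ker ℓ ≤ LinearMap.ker (LinearMap.toSpanSingleton R M (f ^ a • x)) := by
    intro r hr
    rw [LinearMap.mem_ker, hℓ, Submodule.mkQ_apply, Submodule.Quotient.mk_eq_zero] at hr
    obtain ⟨j, hj, h⟩ := hAR r hr
    have h3 : f ^ a * (r - j) = 0 := ha _ (by rw [mul_sub]; exact sub_eq_zero.2 h)
    rw [mul_sub, sub_eq_zero] at h3
    rw [LinearMap.mem_ker, LinearMap.toSpanSingleton_apply, smul_smul, mul_comm, h3, mul_smul,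
      hu j hj, smul_zero]
  obtain ⟨h, hh⟩ := hM.out ((LinearMap.ker ℓ).liftQ ℓ le_rfl)
    (LinearMap.ker_eq_bot.1 (Submodule.ker_liftQ_eq_bot _ _ _ le_rfl))
    ((LinearMap.ker ℓ).liftQ _ hker)
  have h1 := hh (Submodule.Quotient.mk 1)
  rw [Submodule.liftQ_apply, Submodule.liftQ_apply, hℓ, LinearMap.toSpanSingleton_apply,
    one_smul] at h1
  refine ⟨a, h ((J ^ (u + c)).mkQ 1), ?_, ?_⟩
  · intro j hj
    refine ⟨u + c, ?_⟩
    rw [← map_smul, ← map_smul, smul_eq_mul, mul_one, Submodule.mkQ_apply,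
      (Submodule.Quotient.mk_eq_zero _).2, map_zero]
    exact Ideal.pow_mem_pow (Ideal.subset_span (Set.mem_image_of_mem θ (Set.mem_Iio.2 hj))) _
  · rw [← h1, ← map_smul, ← map_smul, smul_eq_mul]
end

section
variable {R : Type} [CommRing R] {E : ℕ → Type} [∀ i, AddCommGroup (E i)] [∀ i, Module R (E i)]

/-- The coboundaries of the subcomplex of joint torsion elements. -/
def torsionBoundary (θ : ℕ → R) (k : ℕ) (d : ∀ i, E i →ₗ[R] E (i + 1)) : ∀ i, Submodule R (E i)
  | 0 => ⊥
  | i + 1 => (jointTorsion θ k (E i)).map (d i)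

variable {d : ∀ i, E i →ₗ[R] E (i + 1)} {θ : ℕ → R}

lemma apply_eq_zero_of_mem_torsionBoundary (hdd : ∀ i x, d (i + 1) (d i x) = 0) {k i : ℕ} {x : E i}
    (hx : x ∈ torsionBoundary θ k d i) : d i x = 0 := by
  cases i with
  | zero => rw [(Submodule.mem_bot R).1 hx, map_zero]
  | succ i =>
    obtain ⟨y, -, rfl⟩ := hx
    exact hdd i y

lemma torsionBoundary_le {k i : ℕ} : torsionBoundary θ k d i ≤ jointTorsion θ k (E i) := by
  cases i with
  | zero => exact bot_le
  | succ i =>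
    rintro _ ⟨y, hy, rfl⟩
    exact map_mem_jointTorsion _ hy

variable [IsNoetherianRing R]

/-- Coboundaries of the joint torsion subcomplex are divisible by powers of `f` modulo powers of
`f`. -/
lemma exists_torsionBoundary_pow_smul_eq (hE : ∀ i, Module.Injective R (E i)) {k i : ℕ} {x : E i}
    (hx : x ∈ torsionBoundary θ k d i) (f : R) (t : ℕ) :
    ∃ a : ℕ, ∃ y ∈ torsionBoundary θ k d i, f ^ (a + t) • y = f ^ a • x := by
  cases i with
  | zero => exact ⟨0, 0, zero_mem _, by rw [(Submodule.mem_bot R).1 hx]; simp⟩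
  | succ i =>
    obtain ⟨y, hy, rfl⟩ := hx
    obtain ⟨a, w, hw, h⟩ := exists_pow_smul_eq_pow_smul (hE i) hy f t
    exact ⟨a, d i w, ⟨w, hw, rfl⟩, by rw [← map_smul, h, map_smul]⟩

/-- The cohomology of the joint torsion subcomplex for `k` elements vanishes above degree `k`. -/
lemma mem_torsionBoundary_of_lt (hdd : ∀ i x, d (i + 1) (d i x) = 0)
    (hE : ∀ i, Module.Injective R (E i)) (hex : ∀ i x, d (i + 1) x = 0 → ∃ y, d i y = x) (k : ℕ) :
    ∀ i, k ≤ i → ∀ x : E (i + 1), x ∈ jointTorsion θ k (E (i + 1)) → d (i + 1) x = 0 →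
      ∃ y ∈ jointTorsion θ k (E i), d i y = x := by
  induction k with
  | zero =>
    intro i _ x _ hx
    obtain ⟨y, hy⟩ := hex i x hx
    exact ⟨y, fun j hj => absurd hj (Nat.not_lt_zero _), hy⟩
  | succ k ih =>
    intro i hi c hc hdc
    obtain ⟨hc, t, ht⟩ := jointTorsion_succ.1 hc
    obtain ⟨y, hy, rfl⟩ := ih i (by omega) c hc hdc
    obtain ⟨j, rfl⟩ : ∃ j, i = j + 1 := ⟨i - 1, by omega⟩
    obtain ⟨v, hv, hvy⟩ := ih j (by omega) (θ k ^ t • y) (Submodule.smul_mem _ _ hy)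
      (by rw [map_smul, ht])
    obtain ⟨a, w, hw, h⟩ := exists_pow_smul_eq_pow_smul (hE j) hv (θ k) t
    refine ⟨y - d j w, jointTorsion_succ.2 ⟨sub_mem hy (map_mem_jointTorsion _ hw), a + t, ?_⟩, ?_⟩
    · rw [smul_sub, ← map_smul, h, map_smul, hvy, smul_smul, ← pow_add, sub_self]
    · rw [map_sub, hdd, sub_zero]

/-- A presentation of the `k`-th cohomology of the joint torsion subcomplex for `k` elements, as a
direct limit of quotients of `R`. -/
lemma exists_top_cohomology_generators (hdd : ∀ i x, d (i + 1) (d i x) = 0)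
    (hE : ∀ i, Module.Injective R (E i)) (hex : ∀ i x, d (i + 1) x = 0 → ∃ y, d i y = x)
    (e : E 0) (he : ∀ x, d 0 x = 0 ↔ ∃ r : R, r • e = x) (he' : ∀ r : R, r • e = 0 → r = 0)
    (k : ℕ) :
    ∃ c : ℕ → E k, (∀ t, c t ∈ jointTorsion θ k (E k)) ∧ (∀ t, d k (c t) = 0) ∧
      (∀ x ∈ jointTorsion θ k (E k), d k x = 0 → ∃ (t : ℕ) (r : R),
        x - r • c t ∈ torsionBoundary θ k d k) ∧
      (∀ t, c t - (∏ i ∈ Finset.range k, θ i) • c (t + 1) ∈ torsionBoundary θ k d k) ∧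
      (∀ t (r : R), r • c t ∈ torsionBoundary θ k d k →
        ∃ a, (∏ i ∈ Finset.range k, θ i) ^ a * r ∈
          Ideal.span ((fun i => θ i ^ (a + t)) '' Set.Iio k)) := by
  induction k with
  | zero =>
    refine ⟨fun _ => e, fun _ j hj => absurd hj (Nat.not_lt_zero _),
      fun _ => (he e).2 ⟨1, one_smul _ _⟩, fun x _ hx => ?_, fun t => ?_, fun t r hr => ?_⟩
    · obtain ⟨r, rfl⟩ := (he x).1 hx
      exact ⟨0, r, by simp⟩
    · simp
    · exact ⟨0, by rw [he' r hr]; simp⟩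
  | succ k ih =>
    obtain ⟨c, hcΓ, hdc, hsurj, htrans, hinj⟩ := ih
    set Θ := ∏ i ∈ Finset.range k, θ i with hΘ
    set f := θ k with hf
    set B := torsionBoundary θ k d k with hB
    have htrans' : ∀ t n : ℕ, c t - Θ ^ n • c (t + n) ∈ B := by
      intro t n
      induction n with
      | zero => simp
      | succ n ihn =>
        have := add_mem ihn (B.smul_mem (Θ ^ n) (htrans (t + n)))
        rwa [smul_sub, smul_smul, ← pow_succ, add_assoc, sub_add_sub_cancel] at this
    have hsurj' : ∀ x ∈ jointTorsion θ k (E k), d k x = 0 → ∀ T₀ : ℕ, ∃ (n : ℕ) (r : R),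
        x - r • c (T₀ + n) ∈ B := by
      intro x hx hdx T₀
      obtain ⟨t, r, hr⟩ := hsurj x hx hdx
      refine ⟨t, r * Θ ^ T₀, ?_⟩
      have := add_mem hr (B.smul_mem r (htrans' t T₀))
      rwa [smul_sub, smul_smul, sub_add_sub_cancel, add_comm t] at this
    choose A y hyΓ hy using fun t => exists_pow_smul_eq_pow_smul (hE k) (hcΓ t) f t
    -- an element of `Γ_k` killed by a power of `f` modulo boundaries
    have hkill : ∀ (b : ℕ) (x : E k), x ∈ jointTorsion θ k (E k) → f ^ b • x ∈ B →
        d k x ∈ torsionBoundary θ (k + 1) d (k + 1) := by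
      intro b x hx hbx
      obtain ⟨a, w, hw, h⟩ := exists_torsionBoundary_pow_smul_eq hE hbx f b
      refine ⟨x - w, jointTorsion_succ.2 ⟨sub_mem hx (torsionBoundary_le hw), a + b, ?_⟩, ?_⟩
      · rw [smul_sub, h, smul_smul, ← pow_add, sub_self]
      · rw [map_sub, apply_eq_zero_of_mem_torsionBoundary hdd hw, sub_zero]
    have hprod : ∏ i ∈ Finset.range (k + 1), θ i = Θ * f := Finset.prod_range_succ _ _
    refine ⟨fun t => d k (y t), fun t => ?_, fun t => hdd k _, ?_, fun t => ?_, fun t r hr => ?_⟩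
    · refine jointTorsion_succ.2 ⟨map_mem_jointTorsion _ (hyΓ t), A t + t, ?_⟩
      rw [← map_smul, hy, map_smul, hdc, smul_zero]
    · intro x hx hdx
      obtain ⟨hx, t, ht⟩ := jointTorsion_succ.1 hx
      obtain ⟨v, hv, rfl⟩ := mem_torsionBoundary_of_lt hdd hE hex k k le_rfl x hx hdx
      obtain ⟨n, r, hr⟩ := hsurj' (f ^ t • v) (Submodule.smul_mem _ _ hv)
        (by rw [map_smul, ht]) t
      refine ⟨t + n, r * f ^ n, ?_⟩
      rw [← map_smul, ← map_sub]
      refine hkill (A (t + n) + t) _ (sub_mem hv (Submodule.smul_mem _ _ (hyΓ _))) ?_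
      convert B.smul_mem (f ^ A (t + n)) hr using 1
      rw [smul_sub, smul_sub]
      congr 1
      · rw [smul_smul, ← pow_add]
      · rw [smul_comm (f ^ A (t + n)) r, ← hy, smul_smul, smul_smul]
        congr 1
        ring
    · rw [← map_smul, ← map_sub, hprod]
      refine hkill (A t + A (t + 1) + t) _ (sub_mem (hyΓ t) (Submodule.smul_mem _ _ (hyΓ _))) ?_
      convert B.smul_mem (f ^ (A t + A (t + 1))) (htrans t) using 1
      rw [smul_sub, smul_sub]
      congr 1
      · rw [show f ^ (A t + A (t + 1) + t) = f ^ A (t + 1) * f ^ (A t + t) by ring, mul_smul, hy,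
          smul_smul, ← pow_add, add_comm]
      · rw [smul_smul, show f ^ (A t + A (t + 1) + t) * (Θ * f) =
          f ^ A t * Θ * f ^ (A (t + 1) + (t + 1)) by ring, mul_smul, hy, smul_smul, smul_smul]
        congr 1
        ring
    · obtain ⟨v, hv, hdv⟩ := hr
      obtain ⟨hv, b, hb⟩ := jointTorsion_succ.1 hv
      obtain ⟨n, r', hr'⟩ := hsurj' (r • y t - v) (sub_mem (Submodule.smul_mem _ _ (hyΓ t)) hv)
        (by rw [map_sub, map_smul, hdv, sub_self]) t
      obtain ⟨a, ha⟩ := hinj (t + n) (f ^ (b + A t) * r * Θ ^ n - f ^ (b + A t + t) * r') (by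
        have h1 := B.smul_mem (f ^ (b + A t + t)) hr'
        have h2 := B.smul_mem (f ^ (b + A t) * r) (htrans' t n)
        have h3 : f ^ (b + A t + t) • r • y t = (f ^ (b + A t) * r) • c t := by
          rw [show f ^ (b + A t + t) = f ^ b * f ^ (A t + t) by ring, smul_comm, mul_smul, hy,
            smul_smul, smul_smul]
          congr 1
          ring
        have h4 : f ^ (b + A t + t) • v = 0 := by
          rw [show f ^ (b + A t + t) = f ^ (A t + t) * f ^ b by ring, mul_smul, hb, smul_zero]
        have h5 := sub_mem h1 h2
        rw [smul_sub, smul_sub, h3, h4, sub_zero, smul_sub, sub_sub_sub_cancel_left, smul_smul,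
          smul_smul, ← sub_smul] at h5
        exact h5)
      set J := Ideal.span ((fun i => θ i ^ (a + n + (b + A t) + t)) '' Set.Iio (k + 1)) with hJ
      have h1 : ∀ z ∈ Ideal.span ((fun i => θ i ^ (a + (t + n))) '' Set.Iio k),
          Θ ^ (b + A t) * z ∈ J := by
        intro z hz
        induction hz using Submodule.span_induction with
        | mem z hz =>
          obtain ⟨i, hi, rfl⟩ := hz
          obtain ⟨q, hq⟩ : θ i ∣ Θ := Finset.dvd_prod_of_mem _ (Finset.mem_range.2 hi)
          have : Θ ^ (b + A t) * θ i ^ (a + (t + n)) =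
              q ^ (b + A t) * θ i ^ (a + n + (b + A t) + t) := by
            rw [hq]; ring
          dsimp only
          rw [this]
          exact J.mul_mem_left _ (Ideal.subset_span ⟨i, Nat.lt_succ_of_lt hi, rfl⟩)
        | zero => simp
        | add x y _ _ hx hy => rw [mul_add]; exact add_mem hx hy
        | smul s x _ hx => rw [smul_eq_mul, mul_left_comm]; exact J.mul_mem_left _ hx
      have h2 : f ^ (a + n + (b + A t) + t) ∈ J :=
        Ideal.subset_span ⟨k, Nat.lt_succ_self k, rfl⟩
      refine ⟨a + n + (b + A t), ?_⟩
      have h3 := J.add_mem (J.mul_mem_left (f ^ (a + n)) (h1 _ ha))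
        (J.mul_mem_left (Θ ^ (b + A t + a) * r') h2)
      convert h3 using 1
      rw [hprod]
      ring
end

section
variable {R : Type} [CommRing R]

/-- If local cohomology in degree `n + 1` vanishes and `θ 0, …, θ n ∈ I` generate `I` up to radical
after inverting `δ`, then the top Čech cohomology of the `θ i` vanishes after inverting `δ`. -/
lemma exists_mem_span_pow_of_subsingleton_localCohomology [IsNoetherianRing R] (I : Ideal R)
    (n : ℕ) (h : Subsingleton ((localCohomology I (n + 1)).obj (ModuleCat.of R R))) (θ : ℕ → R)
    (hθ : ∀ i < n + 1, θ i ∈ I) (δ : R)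
    (hδ : Ideal.span {δ} * I ≤ (Ideal.span (θ '' Set.Iio (n + 1))).radical) :
    ∃ a N : ℕ, (∏ i ∈ Finset.range (n + 1), θ i) ^ a * δ ^ N ∈
      Ideal.span ((fun i => θ i ^ (a + 1)) '' Set.Iio (n + 1)) := by
  let Q := injectiveResolution (ModuleCat.of R R)
  let E : ℕ → Type := fun i => Q.cocomplex.X i
  let d : ∀ i, E i →ₗ[R] E (i + 1) := fun i => (Q.cocomplex.d i (i + 1)).hom
  obtain ⟨η, hη, hmono, hlift⟩ := InjectiveResolution.exists_augmentation Q
  have hE : ∀ i, Module.Injective R (E i) := fun i =>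
    Module.injective_module_of_injective_object (inj := Q.injective i) R (Q.cocomplex.X i)
  have hdd : ∀ i x, d (i + 1) (d i x) = 0 := fun i x =>
    congrArg (fun f => f.hom x) (Q.cocomplex.d_comp_d i (i + 1) (i + 2))
  have hex : ∀ i x, d (i + 1) x = 0 → ∃ y, d i y = x := fun i x hx =>
    (ShortComplex.moduleCat_exact_iff _).1 (Q.exact_succ i) x hx
  have he : ∀ x : E 0, d 0 x = 0 ↔ ∃ r : R, r • η.hom (1 : R) = x := by
    intro x
    constructor
    · intro hx
      obtain ⟨φ, hφ⟩ := hlift (A := ModuleCat.of R R) (ModuleCat.ofHom (LinearMap.toSpanSingleton R _ x))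
        (ModuleCat.hom_ext (LinearMap.ext_ring (by
          change d 0 ((1 : R) • x) = 0
          rw [one_smul, hx])))
      refine ⟨φ.hom (1 : R), ?_⟩
      have h1 : η.hom (φ.hom (1 : R)) = (1 : R) • x := congrArg (fun f => f.hom (1 : R)) hφ
      rw [one_smul] at h1
      rw [← h1, ← map_smul]
      exact congrArg _ (mul_one _)
    · rintro ⟨r, rfl⟩
      rw [map_smul]
      have : d 0 (η.hom (1 : R)) = 0 := congrArg (fun f => f.hom (1 : R)) hη
      rw [this, smul_zero]
  have he' : ∀ r : R, r • η.hom (1 : R) = 0 → r = 0 := by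
    intro r hr
    rw [← map_smul] at hr
    have := (ModuleCat.mono_iff_injective η).1 hmono (hr.trans (map_zero η.hom).symm)
    simpa using this
  obtain ⟨c, hcΓ, hdc, -, -, hinj⟩ :=
    exists_top_cohomology_generators (d := d) (θ := θ) hdd hE hex _ he he' (n + 1)
  obtain ⟨u, hu⟩ := exists_span_pow_smul_eq_zero (hcΓ 1)
  obtain ⟨M, hM⟩ := Ideal.exists_pow_le_of_le_radical_of_fg hδ (IsNoetherian.noetherian _)
  have hkill : ∀ r ∈ I ^ (M * u), r • δ ^ (M * u) • c 1 = 0 := by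
    intro r hr
    rw [smul_smul]
    refine hu _ (Ideal.pow_right_mono hM u ?_)
    rw [← pow_mul, mul_pow, mul_comm r]
    exact Ideal.mul_mem_mul (Ideal.pow_mem_pow (Ideal.mem_span_singleton_self δ) _) hr
  obtain ⟨z, hz, t, hzt⟩ := exists_torsion_primitive I n _ h Q (δ ^ (M * u) • c 1)
    (by
      have := hdc 1
      change d (n + 1) (δ ^ (M * u) • c 1) = 0
      rw [map_smul, this, smul_zero]) _ hkill
  obtain ⟨a, ha⟩ := hinj 1 (δ ^ (M * u)) ⟨z, fun j hj =>
    ⟨t, hzt _ (Ideal.pow_mem_pow (hθ j hj) t)⟩, hz⟩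
  exact ⟨a, _, ha⟩
end

end LocalCohomology

section
variable {k V : Type*} [Field k] [AddCommGroup V] [Module k V] {p : ℕ} {v : Fin p → V}

lemma LinearIndepOn.notMem_span_erase {b : Finset (Fin p)}
    (hb : LinearIndepOn k v (b : Set (Fin p))) {c : Fin p} (hc : c ∈ b) :
    v c ∉ Submodule.span k (v '' (b.erase c : Finset (Fin p))) := by
  rw [← Finset.insert_erase hc, Finset.coe_insert, linearIndepOn_insert (by simp)] at hb
  exact hb.2

lemma exists_exchange_of_notMem [FiniteDimensional k V] {b i : Finset (Fin p)}
    (hb : LinearIndepOn k v (b : Set (Fin p))) (hi : LinearIndepOn k v (i : Set (Fin p)))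
    (hcard : i.card = Module.finrank k V) {c : Fin p} (hcb : c ∈ b) (hci : c ∉ i)
    (hlt : ∀ x ∈ i, x < c → x ∈ b) :
    ∃ i' : Finset (Fin p), LinearIndepOn k v (i' : Set (Fin p)) ∧ i'.card = i.card ∧
      ∑ x ∈ i', (x : ℕ) < ∑ x ∈ i, (x : ℕ) := by
  have hspan : Submodule.span k (v '' i) = ⊤ := by
    have h := LinearIndependent.span_eq_top_of_card_eq_finrank' (K := k) (b := fun x : i => v x) hi
      (by simpa using hcard)
    rw [← h]
    congr 1
    ext; simp
  obtain ⟨a, ha⟩ : ∃ a : Fin p → k, ∑ x ∈ i, a x • v x = v c := by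
    have : v c ∈ Submodule.span k (v '' i) := by rw [hspan]; trivial
    rwa [Submodule.mem_span_image_finset_iff_exists_fun'] at this
  obtain ⟨e, hei, hce, hae⟩ : ∃ e ∈ i, c < e ∧ a e ≠ 0 := by
    by_contra! H
    refine hb.notMem_span_erase hcb ?_
    rw [← ha]
    refine Submodule.sum_mem _ fun x hx => ?_
    rcases lt_trichotomy x c with h | h | h
    · exact Submodule.smul_mem _ _ (Submodule.subset_span ⟨x, by simp [hlt x hx h, h.ne], rfl⟩)
    · exact absurd (h ▸ hx) hci
    · rw [H x hx h, zero_smul]; exact zero_mem _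
  have hne : c ∉ i.erase e := fun h => hci (Finset.mem_of_mem_erase h)
  refine ⟨insert c (i.erase e), ?_, ?_, ?_⟩
  · rw [Finset.coe_insert]
    refine LinearIndepOn.insert (hi.mono (by simp)) fun hc => hi.notMem_span_erase hei ?_
    rw [← Finset.add_sum_erase i _ hei, ← eq_sub_iff_add_eq] at ha
    rw [← inv_smul_smul₀ hae (v e), ha]
    exact Submodule.smul_mem _ _ (sub_mem hc (Submodule.sum_mem _ fun x hx =>
      Submodule.smul_mem _ _ (Submodule.subset_span ⟨x, hx, rfl⟩)))
  · rw [Finset.card_insert_of_notMem hne, Finset.card_erase_add_one hei]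
  · rw [Finset.sum_insert hne, ← Finset.add_sum_erase i _ hei]
    exact Nat.add_lt_add_right hce _

/-- Among the maximal independent subsets of a family of vectors, the one with minimal sum of
indices is unique. -/
lemma eq_of_minimal_index_sum [FiniteDimensional k V] {b i : Finset (Fin p)}
    (hb : LinearIndepOn k v (b : Set (Fin p))) (hi : LinearIndepOn k v (i : Set (Fin p)))
    (hbc : b.card = Module.finrank k V) (hic : i.card = Module.finrank k V)
    (hs : ∑ x ∈ b, (x : ℕ) = ∑ x ∈ i, (x : ℕ))
    (hmin : ∀ i' : Finset (Fin p), LinearIndepOn k v (i' : Set (Fin p)) →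
      i'.card = Module.finrank k V → ∑ x ∈ i, (x : ℕ) ≤ ∑ x ∈ i', (x : ℕ)) : b = i := by
  by_contra hne
  obtain ⟨c, hc, hcmin⟩ := (symmDiff b i).exists_minimal (by simpa [Finset.nonempty_iff_ne_empty])
  have hlt : ∀ x, x < c → (x ∈ b ↔ x ∈ i) := by
    intro x hx
    by_contra h
    refine absurd (hcmin (y := x) ?_ hx.le) (not_le.2 hx)
    change x ∈ symmDiff b i
    rw [Finset.mem_symmDiff]
    tauto
  rcases Finset.mem_symmDiff.1 hc with ⟨h1, h2⟩ | ⟨h1, h2⟩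
  · obtain ⟨i', h, h', h''⟩ := exists_exchange_of_notMem hb hi hic h1 h2 fun x hx hxc =>
      (hlt x hxc).2 hx
    exact absurd (hmin i' h (h'.trans hic)) (not_le.2 h'')
  · obtain ⟨i', h, h', h''⟩ := exists_exchange_of_notMem hi hb hbc h1 h2 fun x hx hxc =>
      (hlt x hxc).1 hx
    exact absurd (hmin i' h (h'.trans hbc)) (not_le.2 (hs ▸ h''))
end

section
variable {A B : Type*} [CommRing A] [CommRing B] {p s : ℕ}

/-- The sum of the maximal minors of `Y` whose row indices add up to `ℓ`. -/
def minorSum (Y : Matrix (Fin p) (Fin s) A) (ℓ : ℕ) : A :=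
  ∑ g : Fin s ↪o Fin p with ∑ x, (g x : ℕ) = ℓ, (Y.submatrix g id).det

lemma map_minorSum (f : A →+* B) (Y : Matrix (Fin p) (Fin s) A) (ℓ : ℕ) :
    f (minorSum Y ℓ) = minorSum (Y.map f) ℓ := by
  simp only [minorSum, map_sum, RingHom.map_det]
  rfl

lemma minorSum_mul (Y : Matrix (Fin p) (Fin s) A) (Z : Matrix (Fin s) (Fin s) A) (ℓ : ℕ) :
    minorSum (Y * Z) ℓ = minorSum Y ℓ * Z.det := by
  rw [minorSum, minorSum, Finset.sum_mul]
  refine Finset.sum_congr rfl fun g _ => ?_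
  rw [← Matrix.det_mul]
  rfl

/-- Over a field, if some maximal minor is nonzero, then some `minorSum` is nonzero. -/
lemma exists_minorSum_ne_zero {k : Type*} [Field k] (Y : Matrix (Fin p) (Fin s) k)
    (g : Fin s ↪o Fin p) (hg : (Y.submatrix g id).det ≠ 0) :
    ∃ h : Fin s ↪o Fin p, minorSum Y (∑ x, (h x : ℕ)) ≠ 0 := by
  classical
  let T : Finset (Fin s ↪o Fin p) := Finset.univ.filter fun g => (Y.submatrix g id).det ≠ 0
  obtain ⟨h, hT, hmin⟩ := T.exists_min_image (fun g => ∑ x, (g x : ℕ)) ⟨g, by simp [T, hg]⟩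
  have hTdet : ∀ g, g ∈ T ↔ (Y.submatrix g id).det ≠ 0 := fun g => by simp [T]
  have hind : ∀ g : Fin s ↪o Fin p, (Y.submatrix g id).det ≠ 0 ↔
      LinearIndepOn k Y (Finset.univ.map g.toEmbedding : Finset (Fin p)) := by
    intro g
    rw [← isUnit_iff_ne_zero, ← Matrix.isUnit_iff_isUnit_det,
      ← Matrix.linearIndependent_rows_iff_isUnit]
    have := linearIndepOn_range_iff (R := k) (f := g) (g := Y) g.injective
    simp only [Finset.coe_map, Finset.coe_univ, Set.image_univ]
    exact this.symm
  have hsum : ∀ g : Fin s ↪o Fin p, 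
      ∑ x ∈ (Finset.univ.map g.toEmbedding : Finset (Fin p)), (x : ℕ) = ∑ x, (g x : ℕ) :=
    fun g => Finset.sum_map _ _ _
  have hcard : ∀ g : Fin s ↪o Fin p, (Finset.univ.map g.toEmbedding : Finset (Fin p)).card =
      Module.finrank k (Fin s → k) := fun g => by simp
  refine ⟨h, ?_⟩
  rw [minorSum, Finset.sum_eq_single h]
  · exact (hTdet h).1 hT
  · intro g hg hne
    rw [Finset.mem_filter] at hg
    by_contra hdet
    refine hne ?_
    have heq := eq_of_minimal_index_sum ((hind g).1 hdet) ((hind h).1 ((hTdet h).1 hT)) (hcard g)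
      (hcard h) (by rw [hsum, hsum, hg.2]) (by
        intro i' hi' hc
        have hc' : i'.card = s := by simpa using hc
        have hi'' : Finset.univ.map (i'.orderEmbOfFin hc').toEmbedding = i' := by
          rw [Finset.map_eq_image]
          exact Finset.image_orderEmbOfFin_univ _ _
        rw [hsum, ← hi'', hsum]
        exact hmin _ ((hTdet _).2 ((hind _).2 (by rwa [hi'']))))
    refine DFunLike.coe_injective ((StrictMono.range_inj g.strictMono h.strictMono).1 ?_)
    have := congrArg (fun s : Finset (Fin p) => (s : Set (Fin p))) heq
    simpa using this
  · intro h'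
    simp at h'
end

section
variable {A : Type*} [CommRing A] {p s : ℕ}

lemma orderEmb_fin_bounds (g : Fin s ↪o Fin p) (x : Fin s) :
    (x : ℕ) ≤ g x ∧ (g x : ℕ) + s ≤ p + x := by
  constructor
  · obtain ⟨x, hx⟩ := x
    induction x with
    | zero => exact Nat.zero_le _
    | succ x ih =>
      have h : g ⟨x, by omega⟩ < g ⟨x + 1, hx⟩ := g.strictMono (by simp)
      exact lt_of_le_of_lt (ih (by omega)) h
  · obtain ⟨x, hx⟩ := x
    induction h : s - x generalizing x with
    | zero => omega
    | succ n ih =>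
      by_cases hx' : x + 1 < s
      · have h1 : g ⟨x, hx⟩ < g ⟨x + 1, hx'⟩ := g.strictMono (by simp)
        have h2 := ih (x + 1) hx' (by omega)
        rw [Fin.lt_def] at h1
        dsimp only at h2 ⊢
        omega
      · have := (g ⟨x, hx⟩).2
        dsimp only
        omega

/-- The `i`-th sum of maximal minors by level, counted from the lowest level. -/
def levelMinor (Y : Matrix (Fin p) (Fin s) A) (i : ℕ) : A := minorSum Y (∑ x : Fin s, (x : ℕ) + i)

lemma exists_levelMinor_ne_zero {k : Type*} [Field k] (Y : Matrix (Fin p) (Fin s) k)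
    (g : Fin s ↪o Fin p) (hg : (Y.submatrix g id).det ≠ 0) :
    ∃ i < s * (p - s) + 1, levelMinor Y i ≠ 0 := by
  obtain ⟨h, hh⟩ := exists_minorSum_ne_zero Y g hg
  have h1 : ∑ x : Fin s, (x : ℕ) ≤ ∑ x, (h x : ℕ) :=
    Finset.sum_le_sum fun x _ => (orderEmb_fin_bounds h x).1
  have h2 : ∑ x, (h x : ℕ) ≤ ∑ x : Fin s, (x : ℕ) + s * (p - s) := by
    have : ∑ x, (h x : ℕ) ≤ ∑ x : Fin s, ((x : ℕ) + (p - s)) :=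
      Finset.sum_le_sum fun x _ => by have := orderEmb_fin_bounds h x; omega
    simpa [Finset.sum_add_distrib] using this
  refine ⟨∑ x, (h x : ℕ) - ∑ x : Fin s, (x : ℕ), by omega, ?_⟩
  rwa [levelMinor, Nat.add_sub_cancel' h1]

lemma map_levelMinor {B : Type*} [CommRing B] (f : A →+* B) (Y : Matrix (Fin p) (Fin s) A) (i : ℕ) :
    f (levelMinor Y i) = levelMinor (Y.map f) i := map_minorSum f Y _

lemma levelMinor_mul (Y : Matrix (Fin p) (Fin s) A) (Z : Matrix (Fin s) (Fin s) A) (i : ℕ) :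
    levelMinor (Y * Z) i = levelMinor Y i * Z.det := minorSum_mul Y Z _

lemma levelMinor_mem {I : Ideal A} {Y : Matrix (Fin p) (Fin s) A}
    (h : ∀ g : Fin s ↪o Fin p, (Y.submatrix g id).det ∈ I) (i : ℕ) : levelMinor Y i ∈ I :=
  I.sum_mem fun g _ => h g

/-- The level minors generate the ideal of maximal minors up to radical. -/
lemma det_mem_radical_levelMinor (Y : Matrix (Fin p) (Fin s) A) (g : Fin s ↪o Fin p) :
    (Y.submatrix g id).det ∈
      (Ideal.span (levelMinor Y '' Set.Iio (s * (p - s) + 1))).radical := by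
  rw [Ideal.radical_eq_sInf, Ideal.mem_sInf]
  rintro P ⟨hle, hP⟩
  by_contra hdet
  let f : A →+* FractionRing (A ⧸ P) := (algebraMap (A ⧸ P) _).comp (Ideal.Quotient.mk P)
  have hf : ∀ a, f a = 0 ↔ a ∈ P := fun a => by
    rw [← Ideal.Quotient.eq_zero_iff_mem]
    exact (injective_iff_map_eq_zero' _).1 (IsFractionRing.injective (A ⧸ P) _) _
  obtain ⟨i, hi, hne⟩ := exists_levelMinor_ne_zero (Y.map f) g (by
    have := (hf (Y.submatrix g id).det).not.2 hdet
    rw [RingHom.map_det] at this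
    exact this)
  rw [← map_levelMinor, Ne, hf] at hne
  exact hne (hle (Ideal.subset_span ⟨i, hi, rfl⟩))
end

section
variable {S : Type*} [CommRing S]

lemma det_submatrix_mem_of_orderEmb {J : Ideal S} {p s : ℕ} {Y : Matrix (Fin p) (Fin s) S}
    (h : ∀ g : Fin s ↪o Fin p, (Y.submatrix g id).det ∈ J) (g : Fin s → Fin p) :
    (Y.submatrix g id).det ∈ J := by
  by_cases hg : Function.Injective g
  · let σ := Tuple.sort g
    have hmono : StrictMono (g ∘ σ) :=
      (Tuple.monotone_sort g).strictMono_of_injective (hg.comp σ.injective)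
    have h1 := h (OrderEmbedding.ofStrictMono _ hmono)
    have h2 : (Y.submatrix (OrderEmbedding.ofStrictMono _ hmono) id).det =
        σ.sign * (Y.submatrix g id).det := by
      rw [← Matrix.det_permute]
      rfl
    rw [h2] at h1
    have h3 := J.mul_mem_left ((σ.sign : ℤ) : S) h1
    rwa [← mul_assoc, ← Int.cast_mul, ← Units.val_mul, Int.units_mul_self, Units.val_one,
      Int.cast_one, one_mul] at h3
  · obtain ⟨i, j, hij, hne⟩ := by simpa [Function.Injective] using hg
    rw [Matrix.det_zero_of_row_eq hne]
    · exact J.zero_mem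
    · funext k
      simp [Matrix.submatrix_apply, hij]

lemma det_mem_of_last_columns {J : Ideal S} (r s : ℕ) : ∀ (n : ℕ) (hn : n = r + s)
    (M : Matrix (Fin n) (Fin n) S)
    (_ : ∀ g : Fin s → Fin n, (M.submatrix g fun j : Fin s => (⟨r + j, by have := j.2; omega⟩ : Fin n)).det ∈ J), M.det ∈ J := by
  induction r with
  | zero =>
    intro n hn M hM
    obtain rfl : n = s := by omega
    have := hM id
    simp only [Nat.zero_add] at this
    exact this
  | succ r ih =>
    intro n hn M hM
    obtain ⟨n, rfl⟩ : ∃ k, n = k + 1 := ⟨n - 1, by omega⟩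
    rw [Matrix.det_succ_column_zero]
    refine J.sum_mem fun i _ => J.mul_mem_left _ (ih n (by omega) _ fun g => ?_)
    convert hM (i.succAbove ∘ g) using 2
    ext a b
    simp only [Matrix.submatrix_apply, Function.comp_apply]
    congr 1
    ext
    simp
    omega

variable {r p s : ℕ} (X : Matrix (Fin (r + p)) (Fin (r + s)) S)

/-- The upper left `r × r` block. -/
def cornerBlock : Matrix (Fin r) (Fin r) S := X.submatrix (Fin.castAdd p) (Fin.castAdd s)

/-- The Schur complement of the upper left block, multiplied by the determinant of this block. -/
def scaledSchur : Matrix (Fin p) (Fin s) S :=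
  (cornerBlock X).det • X.submatrix (Fin.natAdd r) (Fin.natAdd r) -
    X.submatrix (Fin.natAdd r) (Fin.castAdd s) * (cornerBlock X).adjugate *
      X.submatrix (Fin.castAdd p) (Fin.natAdd r)

/-- The result of clearing the upper right block by column operations. -/
def clearedMatrix : Matrix (Fin r ⊕ Fin p) (Fin r ⊕ Fin s) S :=
  Matrix.fromBlocks ((cornerBlock X).det • 1) 0
    (X.submatrix (Fin.natAdd r) (Fin.castAdd s) * (cornerBlock X).adjugate) (scaledSchur X)

lemma det_submatrix_mul_pow (h : Fin r ⊕ Fin s → Fin (r + p)) :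
    (X.submatrix h finSumFinEquiv).det * (cornerBlock X).det ^ (r - 1 + s) =
      ((clearedMatrix X).submatrix (finSumFinEquiv.symm ∘ h) id).det := by
  set A := cornerBlock X
  set B := X.submatrix (Fin.castAdd p) (Fin.natAdd r : Fin s → _)
  set C := X.submatrix (Fin.natAdd r : Fin p → _) (Fin.castAdd s)
  set D := X.submatrix (Fin.natAdd r : Fin p → _) (Fin.natAdd r : Fin s → _)
  let T : Matrix (Fin r ⊕ Fin s) (Fin r ⊕ Fin s) S :=
    Matrix.fromBlocks A.adjugate (-(A.adjugate * B)) 0 (A.det • 1)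
  have hT : T.det = A.det ^ (r - 1 + s) := by
    rw [Matrix.det_fromBlocks_zero₂₁, Matrix.det_adjugate, Matrix.det_smul, Matrix.det_one,
      Fintype.card_fin, Fintype.card_fin, mul_one, pow_add]
  have hX : X.submatrix finSumFinEquiv finSumFinEquiv = Matrix.fromBlocks A B C D := by
    ext (i | i) (j | j) <;> rfl
  have hXT : X.submatrix finSumFinEquiv finSumFinEquiv * T = clearedMatrix X := by
    rw [hX, Matrix.fromBlocks_multiply, clearedMatrix]
    congr 1
    · rw [Matrix.mul_adjugate]; simp [A]
    · rw [Matrix.mul_neg, ← Matrix.mul_assoc, Matrix.mul_adjugate]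
      simp
    · simp [A, C]
    · rw [Matrix.mul_neg, ← Matrix.mul_assoc, scaledSchur]
      simp [A, B, C, D, sub_eq_add_neg, add_comm]
  rw [← hT, ← Matrix.det_mul, ← hXT]
  congr 1
  ext i j
  simp [Matrix.mul_apply]

lemma det_scaledSchur_mem [IsDomain S] (hs : 1 ≤ s) (hδ : (cornerBlock X).det ≠ 0) {I : Ideal S}
    (hI : ∀ h : Fin (r + s) → Fin (r + p), (X.submatrix h id).det ∈ I) (g : Fin s → Fin p) :
    ((scaledSchur X).submatrix g id).det ∈ I := by
  have h1 := det_submatrix_mul_pow X (finSumFinEquiv ∘ Sum.map id g)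
  have h2 : ((clearedMatrix X).submatrix
      (finSumFinEquiv.symm ∘ finSumFinEquiv ∘ Sum.map id g) id).det =
      (cornerBlock X).det ^ r * ((scaledSchur X).submatrix g id).det := by
    have : (clearedMatrix X).submatrix (finSumFinEquiv.symm ∘ finSumFinEquiv ∘ Sum.map id g) id =
        Matrix.fromBlocks ((cornerBlock X).det • 1) 0
          ((X.submatrix (Fin.natAdd r) (Fin.castAdd s) * (cornerBlock X).adjugate).submatrix g id)
          ((scaledSchur X).submatrix g id) := by
      ext (i | i) (j | j) <;> simp [clearedMatrix]
    rw [this, Matrix.det_fromBlocks_zero₁₂, Matrix.det_smul, Matrix.det_one, Fintype.card_fin,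
      mul_one]
  have h3 : (cornerBlock X).det ^ (r - 1 + s) =
      (cornerBlock X).det ^ r * (cornerBlock X).det ^ (s - 1) := by
    rcases Nat.eq_zero_or_pos r with rfl | hr
    · simp
    · rw [← pow_add]; congr 1; omega
  have h4 : (X.submatrix (finSumFinEquiv ∘ Sum.map id g) finSumFinEquiv).det ∈ I := by
    have := hI (finSumFinEquiv ∘ Sum.map id g ∘ finSumFinEquiv.symm)
    rw [← Matrix.det_submatrix_equiv_self finSumFinEquiv] at this
    convert this using 2
    ext i j
    simp
  rw [h2, h3, mul_left_comm] at h1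
  rw [← mul_left_cancel₀ (pow_ne_zero r hδ) h1]
  exact I.mul_mem_right _ h4

lemma det_mul_pow_mem {J : Ideal S} (hJ : ∀ g : Fin s → Fin p,
      ((scaledSchur X).submatrix g id).det ∈ J) (h : Fin (r + s) → Fin (r + p)) :
    (X.submatrix h id).det * (cornerBlock X).det ^ (r - 1 + s) ∈ J := by
  have h1 := det_submatrix_mul_pow X (h ∘ finSumFinEquiv)
  have h2 : (X.submatrix (h ∘ finSumFinEquiv) finSumFinEquiv).det = (X.submatrix h id).det := by
    rw [← Matrix.det_submatrix_equiv_self finSumFinEquiv (X.submatrix h id)]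
    rfl
  rw [← h2, h1, ← Matrix.det_submatrix_equiv_self finSumFinEquiv.symm]
  refine det_mem_of_last_columns r s _ rfl _ fun g => ?_
  by_cases hg : ∃ k i, finSumFinEquiv.symm (h (g k)) = Sum.inl i
  · obtain ⟨k, i, hk⟩ := hg
    rw [Matrix.det_eq_zero_of_row_eq_zero k]
    · exact J.zero_mem
    · intro j
      have hj : finSumFinEquiv.symm (⟨r + j, by have := j.2; omega⟩ : Fin (r + s)) = Sum.inr j :=
        finSumFinEquiv_symm_apply_natAdd j
      simp [clearedMatrix, hk, hj]
  · push Not at hg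
    have : ∀ k, ∃ i, finSumFinEquiv.symm (h (g k)) = Sum.inr i := fun k => by
      rcases hk : finSumFinEquiv.symm (h (g k)) with i | i
      · exact absurd hk (hg k i)
      · exact ⟨i, rfl⟩
    choose g' hg' using this
    convert hJ g' using 2
    ext k j
    have hj : finSumFinEquiv.symm (⟨r + j, by have := j.2; omega⟩ : Fin (r + s)) = Sum.inr j :=
      finSumFinEquiv_symm_apply_natAdd j
    simp [clearedMatrix, hg', hj]
end

section

variable {ι κ : Type} [Fintype ι] [DecidableEq ι] [DecidableEq κ]

/-- The polarization operator `∑ i, x_{ia} ∂/∂x_{ib}`. -/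
def polarization (a b : κ) :
    Derivation ℚ (MvPolynomial (ι × κ) ℚ) (MvPolynomial (ι × κ) ℚ) :=
  ∑ i : ι, (X (i, a) : MvPolynomial (ι × κ) ℚ) • pderiv (i, b)

lemma polarization_apply (a b : κ) (f : MvPolynomial (ι × κ) ℚ) :
    polarization a b f = ∑ i : ι, X (i, a) * pderiv (i, b) f := by
  have := congrArg (fun φ : MvPolynomial (ι × κ) ℚ → MvPolynomial (ι × κ) ℚ => φ f)
    (map_sum (Derivation.coeFnAddMonoidHom (R := ℚ) (A := MvPolynomial (ι × κ) ℚ)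
      (M := MvPolynomial (ι × κ) ℚ))
      (fun i => (X (i, a) : MvPolynomial (ι × κ) ℚ) • pderiv (i, b)) Finset.univ)
  rw [Finset.sum_apply] at this
  exact this

lemma polarization_X (a b : κ) (v : ι × κ) :
    polarization a b (X v : MvPolynomial (ι × κ) ℚ) = if v.2 = b then X (v.1, a) else 0 := by
  obtain ⟨i, c⟩ := v
  rw [polarization_apply]
  by_cases h : c = b
  · subst h
    simp [pderiv_X, Pi.single_apply, Finset.sum_ite_eq]
  · rw [if_neg h]
    refine Finset.sum_eq_zero fun j _ => ?_
    rw [pderiv_X_of_ne (by simpa using fun _ => h), mul_zero]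

/-- The polynomials annihilated by the off-diagonal polarization operators. -/
def polarizationInvariants (ι κ : Type) [Fintype ι] [DecidableEq ι] [DecidableEq κ] :
    Subalgebra ℚ (MvPolynomial (ι × κ) ℚ) where
  carrier := {f | ∀ a b : κ, a ≠ b → polarization a b f = 0}
  mul_mem' hf hg a b hab := by simp [hf a b hab, hg a b hab]
  add_mem' hf hg a b hab := by simp [hf a b hab, hg a b hab]
  algebraMap_mem' r a b _ := by simp

variable [Fintype κ] {A : Type*} [CommRing A] [Algebra ℚ A]

/-- Evaluation of a polynomial in the entries of a generic matrix. -/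
def evalMatrix (Y : Matrix ι κ A) : MvPolynomial (ι × κ) ℚ →ₐ[ℚ] A := aeval fun v => Y v.1 v.2

lemma evalMatrix_X (Y : Matrix ι κ A) (v : ι × κ) : evalMatrix Y (X v) = Y v.1 v.2 :=
  aeval_X _ _

/-- The generic translate of `Y` along a one-parameter group of transvections. -/
def genericTransvect (Y : Matrix ι κ A) (a b : κ) : Matrix ι κ (Polynomial A) :=
  Y.map Polynomial.C * Matrix.transvection a b (Polynomial.X : Polynomial A)

lemma genericTransvect_apply (Y : Matrix ι κ A) {a b : κ} (v : ι × κ) :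
    genericTransvect Y a b v.1 v.2 =
      if v.2 = b then Polynomial.C (Y v.1 b) + Polynomial.X * Polynomial.C (Y v.1 a)
      else Polynomial.C (Y v.1 v.2) := by
  rw [genericTransvect]
  split_ifs with hv
  · rw [hv, Matrix.mul_transvection_apply_same]
    simp
  · rw [Matrix.mul_transvection_apply_of_ne _ _ _ _ hv]
    simp

lemma eval_aeval_genericTransvect (Y : Matrix ι κ A) (a b : κ) (c : A)
    (f : MvPolynomial (ι × κ) ℚ) :
    (evalMatrix (genericTransvect Y a b) f).eval c =
      evalMatrix (Y * Matrix.transvection a b c) f := by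
  have : ((Polynomial.aeval c).restrictScalars ℚ).comp
      (evalMatrix (genericTransvect Y a b)) =
      evalMatrix (Y * Matrix.transvection a b c) := by
    ext v
    rw [AlgHom.comp_apply, evalMatrix_X, evalMatrix_X, genericTransvect_apply]
    split_ifs with hv
    · rw [hv, Matrix.mul_transvection_apply_same]
      change Polynomial.aeval c _ = _
      rw [map_add, map_mul, Polynomial.aeval_C, Polynomial.aeval_X, Polynomial.aeval_C]
      rfl
    · rw [Matrix.mul_transvection_apply_of_ne _ _ _ _ hv]
      simp
  rw [← this]
  simp [Polynomial.coe_aeval_eq_eval]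

lemma derivative_aeval_transvection (Y : Matrix ι κ A) {a b : κ} (hab : a ≠ b)
    (f : MvPolynomial (ι × κ) ℚ) :
    Polynomial.derivative (evalMatrix (genericTransvect Y a b) f) =
      evalMatrix (genericTransvect Y a b) (polarization a b f) := by
  induction f using MvPolynomial.induction_on with
  | C r =>
    rw [evalMatrix, aeval_C, Polynomial.algebraMap_apply, Polynomial.derivative_C, ← algebraMap_eq,
      Derivation.map_algebraMap, map_zero]
  | add f g hf hg => simp [hf, hg]
  | mul_X f v hf =>
    have h : Polynomial.derivative (genericTransvect Y a b v.1 v.2) =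
        evalMatrix (genericTransvect Y a b)
          (polarization a b (X v : MvPolynomial (ι × κ) ℚ)) := by
      rw [polarization_X, genericTransvect_apply]
      split_ifs
      · rw [evalMatrix_X, genericTransvect_apply (v := (v.1, a)), if_neg hab]
        simp
      · simp
    rw [map_mul, Polynomial.derivative_mul, hf, evalMatrix_X, h, Derivation.leibniz, map_add,
      smul_eq_mul, smul_eq_mul, map_mul, map_mul, evalMatrix_X]
    ring

lemma aeval_mul_transvection_of_mem [IsDomain A] {f : MvPolynomial (ι × κ) ℚ}
    (hf : f ∈ polarizationInvariants ι κ) (Y : Matrix ι κ A) {a b : κ} (hab : a ≠ b) (c : A) :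
    evalMatrix (Y * Matrix.transvection a b c) f =
      evalMatrix Y f := by
  have : CharZero A := algebraRat.charZero A
  set g := evalMatrix (genericTransvect Y a b) f with hg
  have h0 : Polynomial.derivative g = 0 := by
    rw [hg, derivative_aeval_transvection Y hab, hf a b hab, map_zero]
  have h1 := Polynomial.eq_C_of_derivative_eq_zero h0
  have h2 := fun c => (eval_aeval_genericTransvect Y a b c f).symm
  have h3 := h2 0
  rw [Matrix.transvection_zero, Matrix.mul_one] at h3
  rw [← hg, h1] at h2 h3
  rw [h2, h3]
  simp

lemma mul_diag2n {F : Type*} [Field F] (Y : Matrix ι κ F) {i j : κ} (hij : i ≠ j) {c : F}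
    (hc : c ≠ 0) : Y * (Matrix.SpecialLinearGroup.diag2n hij c hc).1 =
      Y * Matrix.transvection i j c * Matrix.transvection j i (-c⁻¹ : F) *
        Matrix.transvection i j c * Matrix.transvection i j (-1 : F) *
        Matrix.transvection j i (1 : F) * Matrix.transvection i j (-1 : F) := by
  rw [Matrix.SpecialLinearGroup.diag2n_coe]
  ext k l
  rw [Matrix.mul_diagonal]
  by_cases hi : l = i
  · subst hi
    simp only [Matrix.mul_transvection_apply_same, if_true,
      Matrix.mul_transvection_apply_of_ne _ _ _ _ hij,
      Matrix.mul_transvection_apply_of_ne _ _ _ _ hij.symm]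
    field_simp
    ring
  · by_cases hj : l = j
    · subst hj
      simp only [Matrix.mul_transvection_apply_same, if_true, if_neg hi,
        Matrix.mul_transvection_apply_of_ne _ _ _ _ hij,
        Matrix.mul_transvection_apply_of_ne _ _ _ _ hij.symm]
      field_simp
      ring
    · simp [Matrix.mul_transvection_apply_of_ne _ _ _ _ hi,
        Matrix.mul_transvection_apply_of_ne _ _ _ _ hj, hi, hj]

lemma aeval_mul_specialLinear_of_mem {F : Type*} [Field F] [Algebra ℚ F]
    {f : MvPolynomial (ι × κ) ℚ} (hf : f ∈ polarizationInvariants ι κ)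
    (M : Matrix.SpecialLinearGroup κ F) : ∀ Y : Matrix ι κ F,
    evalMatrix (Y * M.1) f = evalMatrix Y f := by
  rcases subsingleton_or_nontrivial κ with h | h
  · intro Y
    have : M = 1 := Subsingleton.elim _ _
    simp [this]
  · refine Matrix.SpecialLinearGroup.diagonal_transvection_induction'
      (fun M => ∀ Y : Matrix ι κ F,
        evalMatrix (Y * M.1) f = evalMatrix Y f) M ?_ ?_ ?_
    · intro i j hij c hc Y
      rw [mul_diag2n Y hij hc]
      simp only [aeval_mul_transvection_of_mem hf _ hij, aeval_mul_transvection_of_mem hf _ hij.symm]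
    · intro i j hij c Y
      exact aeval_mul_transvection_of_mem hf Y hij c
    · intro A B hA hB Y
      rw [Matrix.SpecialLinearGroup.coe_mul, ← Matrix.mul_assoc, hB, hA]

lemma det_mem_polarizationInvariants (g : κ → ι) :
    ((Matrix.of fun (i : ι) (j : κ) => (X (i, j) : MvPolynomial (ι × κ) ℚ)).submatrix g id).det ∈
      polarizationInvariants ι κ := by
  intro a b hab
  set Y := Matrix.of fun (i : ι) (j : κ) => (X (i, j) : MvPolynomial (ι × κ) ℚ)
  have hdet : ∀ {B : Type} [CommRing B] [Algebra ℚ B] (Z : Matrix ι κ B),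
      evalMatrix Z (Y.submatrix g id).det = (Z.submatrix g id).det := by
    intro B _ _ Z
    rw [AlgHom.map_det]
    congr 1
    ext i j
    exact evalMatrix_X _ _
  have h := derivative_aeval_transvection Y hab (Y.submatrix g id).det
  rw [hdet] at h
  have h2 : ((genericTransvect Y a b).submatrix g id).det =
      Polynomial.C (Y.submatrix g id).det := by
    have : (genericTransvect Y a b).submatrix g id =
        (Y.submatrix g id).map Polynomial.C * Matrix.transvection a b (Polynomial.X :
          Polynomial (MvPolynomial (ι × κ) ℚ)) := by
      ext i j; simp [genericTransvect, Matrix.mul_apply]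
    rw [this, Matrix.det_mul, Matrix.det_transvection_of_ne _ _ hab, mul_one, RingHom.map_det]
    rfl
  rw [h2, Polynomial.derivative_C] at h
  have h3 := congrArg (Polynomial.eval 0) h.symm
  rw [eval_aeval_genericTransvect, Matrix.transvection_zero, Matrix.mul_one,
    Polynomial.eval_zero] at h3
  rwa [show evalMatrix Y = AlgHom.id ℚ _ by ext v; simp [evalMatrix_X, Y]] at h3

end

section

variable {σ : Type} [Fintype σ] [DecidableEq σ]

/-- The product of the factorials of the exponents. -/
def multiFactorial (m : σ →₀ ℕ) : ℚ := ∏ v, ((m v).factorial : ℚ)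

lemma multiFactorial_pos (m : σ →₀ ℕ) : 0 < multiFactorial m :=
  Finset.prod_pos fun _ _ => by exact_mod_cast Nat.factorial_pos _

lemma multiFactorial_add_single (m : σ →₀ ℕ) (v : σ) :
    multiFactorial (m + Finsupp.single v 1) = (m v + 1) * multiFactorial m := by
  rw [multiFactorial, multiFactorial, ← Finset.mul_prod_erase _ _ (Finset.mem_univ v),
    ← Finset.mul_prod_erase Finset.univ (fun v => ((m v).factorial : ℚ)) (Finset.mem_univ v),
    ← mul_assoc]
  congr 1
  · simp [Nat.factorial_succ]
  · refine Finset.prod_congr rfl fun w hw => ?_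
    simp [Finsupp.single_eq_of_ne (Finset.ne_of_mem_erase hw)]

/-- The bilinear form for which monomials are orthogonal and have the product of the factorials
of their exponents as squared norm. -/
def fischerForm (σ : Type) [Fintype σ] [DecidableEq σ] :
    LinearMap.BilinForm ℚ (MvPolynomial σ ℚ) :=
  (basisMonomials σ ℚ).constr ℚ fun m => multiFactorial m • lcoeff ℚ m

lemma fischerForm_monomial (m : σ →₀ ℕ) (g : MvPolynomial σ ℚ) :
    fischerForm σ (monomial m 1) g = multiFactorial m * coeff m g := by
  have : fischerForm σ (monomial m 1) = multiFactorial m • lcoeff ℚ m := by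
    rw [show monomial m (1 : ℚ) = basisMonomials σ ℚ m by rw [coe_basisMonomials], fischerForm,
      Module.Basis.constr_basis]
  rw [this]
  rfl

lemma fischerForm_apply (f g : MvPolynomial σ ℚ) :
    fischerForm σ f g = ∑ m ∈ f.support, coeff m f * (multiFactorial m * coeff m g) := by
  conv_lhs => rw [f.as_sum]
  rw [map_sum, LinearMap.sum_apply]
  refine Finset.sum_congr rfl fun m _ => ?_
  rw [show monomial m (coeff m f) = coeff m f • monomial m (1 : ℚ) by simp [smul_monomial],
    map_smul, LinearMap.smul_apply, fischerForm_monomial, smul_eq_mul]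

lemma fischerForm_self_eq_zero {f : MvPolynomial σ ℚ} (h : fischerForm σ f f = 0) : f = 0 := by
  rw [fischerForm_apply, Finset.sum_eq_zero_iff_of_nonneg] at h
  · ext m
    by_contra hm
    rw [coeff_zero] at hm
    have := h m (mem_support_iff.2 hm)
    have h2 := (multiFactorial_pos m).ne'
    simp_all
  · intro m _
    have := multiFactorial_pos m
    rw [mul_left_comm]
    exact mul_nonneg this.le (mul_self_nonneg _)

lemma fischerForm_comm (f g : MvPolynomial σ ℚ) : fischerForm σ f g = fischerForm σ g f := by
  have h (f g : MvPolynomial σ ℚ) : fischerForm σ f g =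
      ∑ m ∈ f.support ∪ g.support, coeff m f * (multiFactorial m * coeff m g) := by
    rw [fischerForm_apply]
    refine Finset.sum_subset Finset.subset_union_left fun m _ hm => ?_
    rw [notMem_support_iff.1 hm, zero_mul]
  rw [h, h, Finset.union_comm]
  exact Finset.sum_congr rfl fun m _ => by ring

lemma fischerForm_X_mul (v : σ) (f g : MvPolynomial σ ℚ) :
    fischerForm σ (X v * f) g = fischerForm σ f (pderiv v g) := by
  induction f using MvPolynomial.induction_on' with
  | monomial m c =>
    rw [show monomial m c = c • monomial m (1 : ℚ) by simp [smul_monomial], mul_smul_comm,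
      map_smul, map_smul, LinearMap.smul_apply, LinearMap.smul_apply, mul_comm, X, monomial_mul,
      one_mul, fischerForm_monomial, fischerForm_monomial, coeff_pderiv,
      multiFactorial_add_single]
    congr 1
    ring
  | add p q hp hq => rw [mul_add, map_add, map_add, LinearMap.add_apply, LinearMap.add_apply, hp, hq]

end

section

variable {ι κ : Type} [Fintype ι] [DecidableEq ι] [DecidableEq κ] [Fintype κ]

lemma fischerForm_polarization (a b : κ) (f g : MvPolynomial (ι × κ) ℚ) :
    fischerForm _ (polarization a b f) g = fischerForm _ f (polarization b a g) := by
  rw [polarization_apply, polarization_apply, map_sum, LinearMap.sum_apply, map_sum]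
  refine Finset.sum_congr rfl fun i _ => ?_
  rw [fischerForm_X_mul, fischerForm_comm, ← fischerForm_X_mul, fischerForm_comm]

lemma totalDegree_polarization_le (a b : κ) (f : MvPolynomial (ι × κ) ℚ) :
    (polarization a b f).totalDegree ≤ f.totalDegree := by
  rw [polarization_apply]
  refine totalDegree_finsetSum_le fun i _ => ?_
  by_cases h : pderiv (i, b) f = 0
  · simp [h]
  refine (totalDegree_mul _ _).trans ?_
  rw [totalDegree_X]
  obtain ⟨m, hm, hm'⟩ := (pderiv (i, b) f).support.exists_mem_eq_sup
    (support_nonempty.2 h) fun m => m.sum fun _ e => e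
  rw [totalDegree, hm']
  have h2 : m + Finsupp.single (i, b) 1 ∈ f.support := by
    rw [mem_support_iff, coeff_pderiv] at hm
    exact mem_support_iff.2 (left_ne_zero_of_mul hm)
  have := le_totalDegree h2
  rw [Finsupp.sum_add_index' (fun _ => rfl) (fun _ _ _ => rfl), Finsupp.sum_single_index rfl]
    at this
  omega

/-- The sum of the images of the off-diagonal polarization operators. -/
def polarizationImage (ι κ : Type) [Fintype ι] [DecidableEq ι] [DecidableEq κ] :
    Submodule ℚ (MvPolynomial (ι × κ) ℚ) :=
  ⨆ (a : κ) (b : κ) (_ : a ≠ b), LinearMap.range (polarization a b).toLinearMap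

lemma mul_mem_polarizationImage {w u : MvPolynomial (ι × κ) ℚ}
    (hw : w ∈ polarizationInvariants ι κ) (hu : u ∈ polarizationImage ι κ) :
    w * u ∈ polarizationImage ι κ := by
  have : polarizationImage ι κ ≤ (polarizationImage ι κ).comap (LinearMap.mulLeft ℚ w) := by
    refine iSup_le fun a => iSup_le fun b => iSup_le fun hab => ?_
    rintro _ ⟨f, rfl⟩
    have h : w * polarization a b f = polarization a b (w * f) := by
      rw [Derivation.leibniz, hw a b hab]; simp
    rw [Submodule.mem_comap, LinearMap.mulLeft_apply]
    change w * polarization a b f ∈ _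
    rw [h]
    exact Submodule.mem_iSup_of_mem a (Submodule.mem_iSup_of_mem b
      (Submodule.mem_iSup_of_mem hab ⟨w * f, rfl⟩))
  exact this hu

lemma eq_zero_of_mem_invariants_of_mem_image {f : MvPolynomial (ι × κ) ℚ}
    (hw : f ∈ polarizationInvariants ι κ) (hu : f ∈ polarizationImage ι κ) : f = 0 := by
  have hB : ∀ u ∈ polarizationImage ι κ, fischerForm _ f u = 0 := by
    have : polarizationImage ι κ ≤ LinearMap.ker (fischerForm (ι × κ) f) := by
      refine iSup_le fun a => iSup_le fun b => iSup_le fun hab => ?_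
      rintro _ ⟨g, rfl⟩
      change fischerForm _ f (polarization a b g) = 0
      rw [← fischerForm_polarization, hw b a hab.symm, map_zero, LinearMap.zero_apply]
    exact fun u hu => this hu
  exact fischerForm_self_eq_zero (hB f hu)

lemma exists_invariant_add_image (f : MvPolynomial (ι × κ) ℚ) :
    ∃ w ∈ polarizationInvariants ι κ, ∃ u ∈ polarizationImage ι κ, f = w + u := by
  let N := f.totalDegree
  let S := restrictTotalDegree (ι × κ) ℚ N
  let U : Submodule ℚ (MvPolynomial (ι × κ) ℚ) :=
    ⨆ (a : κ) (b : κ) (_ : a ≠ b), S.map (polarization a b).toLinearMap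
  have hS : ∀ (a b : κ), ∀ g ∈ S, polarization a b g ∈ S := fun a b g hg => by
    rw [mem_restrictTotalDegree] at hg ⊢
    exact (totalDegree_polarization_le a b g).trans hg
  have hUS : U ≤ S := by
    refine iSup_le fun a => iSup_le fun b => iSup_le fun hab => ?_
    rintro _ ⟨g, hg, rfl⟩
    exact hS a b g hg
  have hUI : U ≤ polarizationImage ι κ :=
    iSup_mono fun a => iSup_mono fun b => iSup_mono fun hab => LinearMap.map_le_range
  have : FiniteDimensional ℚ S := inferInstance
  have : FiniteDimensional ℚ U := Submodule.finiteDimensional_of_le hUS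
  have hinj : Function.Injective ((fischerForm (ι × κ)).restrict U) := by
    refine (injective_iff_map_eq_zero _).2 fun u hu => Subtype.ext ?_
    exact fischerForm_self_eq_zero (congrArg (fun φ : U →ₗ[ℚ] ℚ => φ u) hu)
  obtain ⟨u, hu⟩ := (LinearMap.injective_iff_surjective_of_finrank_eq_finrank
    Subspace.dual_finrank_eq.symm).1 hinj ((fischerForm (ι × κ) f).domRestrict U)
  obtain ⟨w, hw⟩ : ∃ w, w = f - u := ⟨_, rfl⟩
  have hwU : ∀ v ∈ U, fischerForm _ w v = 0 := fun v hv => by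
    rw [hw, map_sub, LinearMap.sub_apply, sub_eq_zero]
    exact (congrArg (fun φ : U →ₗ[ℚ] ℚ => φ ⟨v, hv⟩) hu).symm
  refine ⟨w, fun a b hab => ?_, u, hUI u.2, by rw [hw, sub_add_cancel]⟩
  have hfS : f ∈ S := by rw [mem_restrictTotalDegree]
  have hwS : w ∈ S := by
    rw [hw]
    exact S.sub_mem hfS (hUS u.2)
  apply fischerForm_self_eq_zero
  rw [fischerForm_polarization]
  refine hwU _ ?_
  exact Submodule.mem_iSup_of_mem b (Submodule.mem_iSup_of_mem a
      (Submodule.mem_iSup_of_mem hab.symm ⟨_, hS a b w hwS, rfl⟩))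

end

section

lemma exists_invariant_relation {ι κ : Type} [Fintype ι] [DecidableEq ι] [DecidableEq κ]
    [Fintype κ] {d t : ℕ} {θ : Fin d → MvPolynomial (ι × κ) ℚ}
    (hθ : ∀ i, θ i ∈ polarizationInvariants ι κ) (c : Fin d → MvPolynomial (ι × κ) ℚ)
    (h : (∏ i, θ i) ^ t = ∑ i, c i * θ i ^ (t + 1)) :
    ∃ w : Fin d → MvPolynomial (ι × κ) ℚ, (∀ i, w i ∈ polarizationInvariants ι κ) ∧
      (∏ i, θ i) ^ t = ∑ i, w i * θ i ^ (t + 1) := by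
  choose w hw u hu hwu using fun i => exists_invariant_add_image (c i)
  refine ⟨w, hw, ?_⟩
  have h1 : (∏ i, θ i) ^ t - ∑ i, w i * θ i ^ (t + 1) = ∑ i, θ i ^ (t + 1) * u i := by
    rw [h, ← Finset.sum_sub_distrib]
    refine Finset.sum_congr rfl fun i _ => ?_
    rw [← sub_mul, hwu i]
    ring
  refine sub_eq_zero.1 (eq_zero_of_mem_invariants_of_mem_image ?_ ?_)
  · exact sub_mem (pow_mem (prod_mem fun i _ => hθ i) t)
      (sum_mem fun i _ => mul_mem (hw i) (pow_mem (hθ i) _))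
  · rw [h1]
    exact Submodule.sum_mem _ fun i _ => mul_mem_polarizationImage (pow_mem (hθ i) _) (hu i)

lemma mul_adjugate_apply {R ι κ : Type*} [CommRing R] [Fintype κ] [DecidableEq κ]
    (Y : Matrix ι κ R) (B : Matrix κ κ R) (i : ι) (j : κ) :
    (Y * B.adjugate) i j = (B.updateRow j (Y i)).det := by
  rw [← Matrix.cramer_transpose_apply, Matrix.cramer_eq_adjugate_mulVec,
    ← Matrix.adjugate_transpose, Matrix.mulVec_transpose]
  rfl

lemma submatrix_updateRow {R ι κ : Type*} [DecidableEq κ] (Y : Matrix ι κ R) (g : κ → ι)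
    (i : ι) (j : κ) : (Y.submatrix g id).updateRow j (Y i) =
      Y.submatrix (Function.update g j i) id := by
  ext a b
  by_cases h : a = j
  · subst h; simp
  · simp [h]

lemma evalMatrix_mem {F : Type*} [Field F] [Algebra ℚ F] {ι κ : Type} [Fintype ι]
    [DecidableEq ι] [DecidableEq κ] [Fintype κ] {V : ValuationSubring F}
    (hV : ∀ q : ℚ, algebraMap ℚ F q ∈ V) {Y : Matrix ι κ F} (hY : ∀ i j, Y i j ∈ V)
    (f : MvPolynomial (ι × κ) ℚ) : evalMatrix Y f ∈ V := by
  induction f using MvPolynomial.induction_on with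
  | C r => rw [← algebraMap_eq, AlgHom.commutes]; exact hV r
  | add f g hf hg => rw [map_add]; exact V.add_mem _ _ hf hg
  | mul_X f v hf => rw [map_mul, evalMatrix_X]; exact V.mul_mem _ _ hf (hY _ _)

variable {F : Type*} [Field F] {p s : ℕ}

lemma exists_minor_valuation_le (Y : Matrix (Fin p) (Fin s) F) (V : ValuationSubring F)
    (h : ∃ g : Fin s → Fin p, (Y.submatrix g id).det ≠ 0) :
    ∃ g : Fin s → Fin p, (Y.submatrix g id).det ≠ 0 ∧
      ∀ i j, (Y * (Y.submatrix g id)⁻¹) i j ∈ V := by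
  obtain ⟨g₁, hg₁⟩ := h
  have : Nonempty (Fin s → Fin p) := ⟨g₁⟩
  obtain ⟨g, hg⟩ := Finite.exists_max fun g : Fin s → Fin p =>
    V.valuation (Y.submatrix g id).det
  have hδ : (Y.submatrix g id).det ≠ 0 := by
    intro h0
    have := hg g₁
    rw [h0, map_zero, le_zero_iff, map_eq_zero] at this
    exact hg₁ this
  refine ⟨g, hδ, fun i j => ?_⟩
  rw [← V.valuation_le_one_iff, Matrix.inv_def, Matrix.mul_smul, Matrix.smul_apply,
    mul_adjugate_apply, submatrix_updateRow, Ring.inverse_eq_inv', smul_eq_mul, map_mul, map_inv₀,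
    inv_mul_le_one₀ (zero_lt_iff.2 (by simpa using hδ))]
  exact hg _

lemma exists_valuation_levelMinor_eq_one (V : ValuationSubring F) (Z : Matrix (Fin p) (Fin s) F)
    (hZ : ∀ i j, Z i j ∈ V) (g : Fin s → Fin p) (hg : Z.submatrix g id = 1) :
    ∃ i < s * (p - s) + 1, V.valuation (levelMinor Z i) = 1 := by
  let Z' : Matrix (Fin p) (Fin s) V := Matrix.of fun i j => ⟨Z i j, hZ i j⟩
  have hZ' : Z'.map V.subtype = Z := rfl
  have hg' : Z'.submatrix g id = 1 := by
    ext i j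
    have := congrFun₂ hg i j
    rw [Matrix.one_apply] at this ⊢
    split_ifs at this ⊢ <;> exact this
  let ρ := IsLocalRing.residue V
  have h1 : ∃ e : Fin s ↪o Fin p, ((Z'.map ρ).submatrix e id).det ≠ 0 := by
    by_contra! hcon
    have := det_submatrix_mem_of_orderEmb (J := ⊥) (Y := Z'.map ρ)
      (fun e => Ideal.mem_bot.2 (hcon e)) g
    rw [Matrix.submatrix_map, hg', Ideal.mem_bot, ← RingHom.mapMatrix_apply, map_one,
      Matrix.det_one] at this
    exact one_ne_zero this
  obtain ⟨e, he⟩ := h1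
  obtain ⟨i, hi, hi'⟩ := exists_levelMinor_ne_zero _ e he
  refine ⟨i, hi, ?_⟩
  rw [← map_levelMinor] at hi'
  have hu : IsUnit (levelMinor Z' i) := (IsLocalRing.residue_ne_zero_iff_isUnit _).1 hi'
  rw [← hZ', ← map_levelMinor]
  exact V.valuation_eq_one_iff _ |>.1 hu

lemma evalMatrix_mem_of_levelMinor_mem [Algebra ℚ F] (hs : 1 ≤ s) (Y : Matrix (Fin p) (Fin s) F)
    (hY : ∃ g : Fin s → Fin p, (Y.submatrix g id).det ≠ 0) (V : ValuationSubring F)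
    (hV : ∀ q : ℚ, algebraMap ℚ F q ∈ V) (hθ : ∀ i < s * (p - s) + 1, levelMinor Y i ∈ V)
    {f : MvPolynomial (Fin p × Fin s) ℚ} (hf : f ∈ polarizationInvariants (Fin p) (Fin s)) :
    evalMatrix Y f ∈ V := by
  obtain ⟨g, hδ, hZ⟩ := exists_minor_valuation_le Y V hY
  set B := Y.submatrix g id
  set Z := Y * B⁻¹
  have hB : IsUnit B.det := hδ.isUnit
  have hYZ : Y = Z * B := by
    rw [Matrix.mul_assoc, Matrix.nonsing_inv_mul _ hB, Matrix.mul_one]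
  have hgZ : Z.submatrix g id = 1 := by
    rw [← Matrix.mul_nonsing_inv B hB]
    ext i j
    simp [Z, B, Matrix.mul_apply]
  obtain ⟨i, hi, hiZ⟩ := exists_valuation_levelMinor_eq_one V Z hZ g hgZ
  have hδV : B.det ∈ V := by
    have := hθ i hi
    rw [hYZ, levelMinor_mul, ← V.valuation_le_one_iff, map_mul, hiZ, one_mul] at this
    exact (V.valuation_le_one_iff _).1 this
  let j₀ : Fin s := ⟨0, hs⟩
  let D : Fin s → F := Function.update 1 j₀ B.det
  have hD : (Matrix.diagonal D).det = B.det := by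
    rw [Matrix.det_diagonal, Finset.prod_update_of_mem (Finset.mem_univ _)]
    simp
  have hDu : IsUnit (Matrix.diagonal D).det := hD.symm ▸ hB
  let G : Matrix.SpecialLinearGroup (Fin s) F := ⟨(Matrix.diagonal D)⁻¹ * B, by
    rw [Matrix.det_mul, Matrix.det_nonsing_inv, hD, Ring.inverse_mul_cancel _ hB]⟩
  have hYG : Y = Z * Matrix.diagonal D * G.1 := by
    rw [Matrix.mul_assoc, ← Matrix.mul_assoc (Matrix.diagonal D), Matrix.mul_nonsing_inv _ hDu,
      Matrix.one_mul, ← hYZ]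
  rw [hYG, aeval_mul_specialLinear_of_mem hf]
  refine evalMatrix_mem hV (fun i j => ?_) f
  rw [Matrix.mul_diagonal]
  refine V.mul_mem _ _ (hZ i j) ?_
  by_cases hj : j = j₀
  · simpa [D, hj] using hδV
  · simp [D, hj]

lemma isIntegral_of_forall_mem_valuationSubring {A : Type*} [CommRing A] [Algebra A F] {x : F}
    (h : ∀ V : ValuationSubring F, (∀ a : A, algebraMap A F a ∈ V) → x ∈ V) : IsIntegral A x := by
  by_contra hx
  obtain ⟨V, hV, hxV⟩ := Subring.exists_le_valuationSubring_of_isIntegrallyClosedIn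
    (R := (integralClosure A F).toSubring) (x := x) hx
  exact hxV (h V fun a => hV
    (show algebraMap A F a ∈ (integralClosure A F).toSubring from
      (integralClosure A F).algebraMap_mem a))

lemma isIntegral_evalMatrix [Algebra ℚ F] {A : Type*} [CommRing A] [Algebra A F] [Algebra ℚ A]
    [IsScalarTower ℚ A F] (hs : 1 ≤ s) (Y : Matrix (Fin p) (Fin s) F)
    (hY : ∃ g : Fin s → Fin p, (Y.submatrix g id).det ≠ 0)
    (hθ : ∀ i < s * (p - s) + 1, ∃ a : A, algebraMap A F a = levelMinor Y i)
    {f : MvPolynomial (Fin p × Fin s) ℚ} (hf : f ∈ polarizationInvariants (Fin p) (Fin s)) :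
    IsIntegral A (evalMatrix Y f) := by
  refine isIntegral_of_forall_mem_valuationSubring fun V hV =>
    evalMatrix_mem_of_levelMinor_mem hs Y hY V (fun q => ?_) (fun i hi => ?_) hf
  · rw [IsScalarTower.algebraMap_apply ℚ A F]
    exact hV _
  · obtain ⟨a, ha⟩ := hθ i hi
    exact ha ▸ hV a

end

section

lemma not_integral_monomial_relation {d t : ℕ} {F : Type*} [Field F]
    [Algebra (MvPolynomial (Fin d) ℚ) F] [FaithfulSMul (MvPolynomial (Fin d) ℚ) F]
    {w : Fin d → F} (hw : ∀ i, IsIntegral (MvPolynomial (Fin d) ℚ) (w i)) :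
    algebraMap (MvPolynomial (Fin d) ℚ) F ((∏ i, X i) ^ t) ≠
      ∑ i, w i * algebraMap (MvPolynomial (Fin d) ℚ) F (X i) ^ (t + 1) := by
  intro h
  let A := MvPolynomial (Fin d) ℚ
  let k := FractionRing A
  let _ : Algebra k F := FractionRing.liftAlgebra A F
  have : IsScalarTower A k F := inferInstance
  let M := IntermediateField.adjoin k (Set.range w)
  have hfin : FiniteDimensional k M := IntermediateField.finiteDimensional_adjoin fun x hx => by
    obtain ⟨i, rfl⟩ := hx
    exact (hw i).tower_top
  let v : Fin d → M := fun i => ⟨w i, IntermediateField.subset_adjoin _ _ ⟨i, rfl⟩⟩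
  have hv : ∀ i, IsIntegral A (v i) := fun i =>
    (isIntegral_algHom_iff (M.val.restrictScalars A) M.val.injective).1 (hw i)
  have htr : ∀ i, ∃ c : A, algebraMap A k c = Algebra.trace k M (v i) := fun i =>
    IsIntegrallyClosed.isIntegral_iff.1 (Algebra.isIntegral_trace (hv i))
  choose c hc using htr
  have h1 : algebraMap k M (algebraMap A k ((∏ i, X i) ^ t)) =
      ∑ i, (algebraMap A k (X i ^ (t + 1))) • v i := by
    apply (algebraMap M F).injective
    rw [map_sum, ← IsScalarTower.algebraMap_apply, ← IsScalarTower.algebraMap_apply, h]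
    refine Finset.sum_congr rfl fun i _ => ?_
    rw [Algebra.smul_def, map_mul, ← IsScalarTower.algebraMap_apply,
      ← IsScalarTower.algebraMap_apply, map_pow, mul_comm]
    rfl
  have h2 := congrArg (Algebra.trace k M) h1
  rw [Algebra.trace_algebraMap, map_sum] at h2
  simp only [map_smul, ← hc, smul_eq_mul, ← map_mul, ← map_sum, ← map_nsmul] at h2
  have h3 := congrArg (coeff (Finsupp.equivFunOnFinite.symm fun _ => t))
    (IsFractionRing.injective A k h2)
  have h4 : ((∏ i, X i) ^ t : A) = monomial (Finsupp.equivFunOnFinite.symm fun _ => t) 1 := by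
    rw [monomial_eq, Finsupp.prod_fintype _ _ (fun _ => pow_zero _), ← Finset.prod_pow]
    simp
  rw [h4, coeff_smul, coeff_monomial, if_pos rfl, coeff_sum, Finset.sum_eq_zero] at h3
  · rw [nsmul_eq_mul, mul_one, Nat.cast_eq_zero] at h3
    exact Module.finrank_pos.ne' h3
  · intro i _
    rw [X_pow_eq_monomial, coeff_monomial_mul', if_neg]
    intro hle
    simpa using hle i

end

section

lemma evalMatrix_minor {A : Type*} [CommRing A] [Algebra ℚ A] {ι κ : Type} [Fintype ι]
    [DecidableEq ι] [DecidableEq κ] [Fintype κ] (Y : Matrix ι κ A) (g : κ → ι) :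
    evalMatrix Y ((Matrix.of fun i j => X (i, j)).submatrix g id).det =
      (Y.submatrix g id).det := by
  rw [AlgHom.map_det]
  congr 1
  ext i j
  exact evalMatrix_X Y (g i, j)

variable (q s : ℕ)

/-- The field of rational functions in the entries of `sliceMatrix`. -/
abbrev SliceField : Type := FractionRing (MvPolynomial (Option (Fin q × Fin s)) ℚ)

/-- A generic matrix whose top block is a scalar matrix. -/
def sliceMatrix : Matrix (Fin (s + q)) (Fin s)
    (SliceField q s) :=
  Matrix.of fun i j => algebraMap (MvPolynomial (Option (Fin q × Fin s)) ℚ) _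
    (Fin.addCases (fun a => if a = j then X none else 0) (fun b => X (some (b, j))) i)

lemma sliceMatrix_submatrix : (sliceMatrix q s).submatrix (Fin.castAdd q) id =
    (algebraMap (MvPolynomial (Option (Fin q × Fin s)) ℚ) 
      (SliceField q s) (X none)) •
      (1 : Matrix (Fin s) (Fin s) (SliceField q s)) := by
  ext i j
  by_cases h : i = j <;> simp [sliceMatrix, h]

lemma det_sliceMatrix_ne_zero : ((sliceMatrix q s).submatrix (Fin.castAdd q) id).det ≠ 0 := by
  rw [sliceMatrix_submatrix, Matrix.det_smul, Matrix.det_one, mul_one]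
  exact pow_ne_zero _ (by simp)

variable {q s}

lemma isAlgebraic_sliceMatrix (hs : 1 ≤ s) : Algebra.IsAlgebraic
    (Algebra.adjoin ℚ (Set.range fun i : Fin (s * q + 1) => levelMinor (sliceMatrix q s) i))
    (SliceField q s) := by
  set R := Algebra.adjoin ℚ
    (Set.range fun i : Fin (s * q + 1) => levelMinor (sliceMatrix q s) i) with hR
  let P := MvPolynomial (Option (Fin q × Fin s)) ℚ
  have hdet : ∀ g : Fin s → Fin (s + q), IsIntegral R ((sliceMatrix q s).submatrix g id).det := by
    intro g
    rw [← evalMatrix_minor]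
    refine isIntegral_evalMatrix hs _ ⟨_, det_sliceMatrix_ne_zero q s⟩ (fun i hi => ?_)
      (det_mem_polarizationInvariants g)
    rw [Nat.add_sub_cancel_left] at hi
    exact ⟨⟨_, Algebra.subset_adjoin ⟨⟨i, hi⟩, rfl⟩⟩, rfl⟩
  have h0 : IsIntegral R (algebraMap P (SliceField q s) (X none)) := by
    have := hdet (Fin.castAdd q)
    rw [sliceMatrix_submatrix, Matrix.det_smul, Matrix.det_one, mul_one, Fintype.card_fin] at this
    exact this.of_pow hs
  have h1 : ∀ b j, IsAlgebraic R (algebraMap P (SliceField q s) (X (some (b, j)))) := by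
    intro b j
    have h := hdet (Function.update (Fin.castAdd q) j (Fin.natAdd s b))
    rw [← submatrix_updateRow, ← mul_adjugate_apply, sliceMatrix_submatrix, Matrix.adjugate_smul,
      Matrix.adjugate_one, Matrix.mul_smul, Matrix.mul_one, Matrix.smul_apply, smul_eq_mul,
      Fintype.card_fin] at h
    have h2 := (h0.pow (s - 1)).isAlgebraic.inv.mul h.isAlgebraic
    rw [inv_mul_cancel_left₀ (pow_ne_zero _ (by simp [P]))] at h2
    simpa [sliceMatrix] using h2
  have h2 : ∀ f : P, IsAlgebraic R (algebraMap P (SliceField q s) f) := by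
    intro f
    induction f using MvPolynomial.induction_on with
    | C r =>
      have : algebraMap P (SliceField q s) (C r) = algebraMap R (SliceField q s) (algebraMap ℚ R r) := by
        rw [← algebraMap_eq, ← IsScalarTower.algebraMap_apply, ← IsScalarTower.algebraMap_apply]
      rw [this]
      exact isAlgebraic_algebraMap _
    | add f g hf hg => rw [map_add]; exact hf.add hg
    | mul_X f v hf =>
      rw [map_mul]
      rcases v with _ | ⟨b, j⟩
      · exact hf.mul h0.isAlgebraic
      · exact hf.mul (h1 b j)
  refine ⟨fun x => ?_⟩
  obtain ⟨a, b, -, rfl⟩ := IsFractionRing.div_surjective (A := P) x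
  rw [div_eq_mul_inv]
  exact (h2 a).mul (h2 b).inv

/-- The level minors of a generic matrix are algebraically independent, even after restriction
to a linear slice. -/
lemma algebraicIndependent_levelMinor (hs : 1 ≤ s) :
    AlgebraicIndependent ℚ fun i : Fin (s * q + 1) => levelMinor (sliceMatrix q s) i := by
  have := isAlgebraic_sliceMatrix (q := q) hs
  refine (Algebra.IsAlgebraic.isTranscendenceBasis_of_le_trdeg_of_finite ℚ _ ?_).1
  have := IsLocalization.isAlgebraic (SliceField q s)
    (nonZeroDivisors (MvPolynomial (Option (Fin q × Fin s)) ℚ))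
  have h := ((IsTranscendenceBasis.mvPolynomial (Option (Fin q × Fin s)) ℚ).algebraMap_comp
    (A := SliceField q s)).cardinalMk_eq_trdeg
  rw [← h]
  simp [mul_comm]

/-- The monomial relation witnessing the vanishing of top local cohomology cannot hold for
the level minors of a generic matrix over `ℚ`. -/
lemma levelMinor_relation_ne (hs : 1 ≤ s) (t : ℕ)
    (c : Fin (s * q + 1) → MvPolynomial (Fin (s + q) × Fin s) ℚ) :
    (∏ i : Fin (s * q + 1), levelMinor (Matrix.of fun i j => X (i, j) :
      Matrix (Fin (s + q)) (Fin s) (MvPolynomial (Fin (s + q) × Fin s) ℚ)) i) ^ t ≠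
      ∑ i, c i * levelMinor (Matrix.of fun i j => X (i, j)) i ^ (t + 1) := by
  intro h
  obtain ⟨w, hw, hrel⟩ := exists_invariant_relation
    (θ := fun i : Fin (s * q + 1) => levelMinor (Matrix.of fun i j => X (i, j)) i)
    (fun i => Subalgebra.sum_mem _ fun g _ => det_mem_polarizationInvariants g) c h
  let θ : Fin (s * q + 1) → (SliceField q s) := fun i => levelMinor (sliceMatrix q s) i
  have hθ : AlgebraicIndependent ℚ θ := algebraicIndependent_levelMinor hs
  let _ : Algebra (MvPolynomial (Fin (s * q + 1)) ℚ) (SliceField q s) := (aeval θ).toRingHom.toAlgebra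
  have hmap : ∀ f, algebraMap (MvPolynomial (Fin (s * q + 1)) ℚ) (SliceField q s) f = aeval θ f := fun _ => rfl
  have : FaithfulSMul (MvPolynomial (Fin (s * q + 1)) ℚ) (SliceField q s) :=
    (faithfulSMul_iff_algebraMap_injective _ _).2 hθ
  have : @IsScalarTower ℚ (MvPolynomial (Fin (s * q + 1)) ℚ) (SliceField q s)
      Algebra.toSMul Algebra.toSMul Algebra.toSMul :=
    IsScalarTower.of_algebraMap_eq (R := ℚ) (S := MvPolynomial (Fin (s * q + 1)) ℚ) fun r => by rw [hmap, AlgHom.commutes]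
  have heval : ∀ i, evalMatrix (sliceMatrix q s) (levelMinor (Matrix.of fun i j => X (i, j)) i) =
      levelMinor (sliceMatrix q s) i := fun i => by
    rw [← AlgHom.coe_toRingHom, map_levelMinor]
    congr 1
    ext a b
    exact evalMatrix_X _ (a, b)
  have hint : ∀ i, IsIntegral (MvPolynomial (Fin (s * q + 1)) ℚ)
      (evalMatrix (sliceMatrix q s) (w i)) := fun i => by
    refine isIntegral_evalMatrix hs _ ⟨_, det_sliceMatrix_ne_zero q s⟩ (fun i hi => ?_) (hw i)
    rw [Nat.add_sub_cancel_left] at hi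
    exact ⟨X ⟨i, hi⟩, by rw [hmap, aeval_X]⟩
  refine not_integral_monomial_relation (t := t) hint ?_
  have h1 := congrArg (evalMatrix (sliceMatrix q s)) hrel
  simp only [map_pow, map_prod, map_sum, map_mul, heval] at h1
  simpa only [hmap, map_pow, map_prod, aeval_X] using h1

end

section

lemma exists_rat_coefficients {K : Type*} [Field K] [CharZero K] {σ ι : Type*} [Fintype ι]
    (f : MvPolynomial σ ℚ) (g : ι → MvPolynomial σ ℚ) (c : ι → MvPolynomial σ K)
    (h : map (algebraMap ℚ K) f = ∑ i, c i * map (algebraMap ℚ K) (g i)) :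
    ∃ c' : ι → MvPolynomial σ ℚ, f = ∑ i, c' i * g i := by
  obtain ⟨l, hl⟩ := (Algebra.linearMap ℚ K).exists_leftInverse_of_injective
    (LinearMap.ker_eq_bot.2 (algebraMap ℚ K).injective)
  let L : MvPolynomial σ K → MvPolynomial σ ℚ := fun p =>
    ∑ m ∈ p.support, monomial m (l (coeff m p))
  have hL : ∀ p m, coeff m (L p) = l (coeff m p) := fun p m => by
    classical
    simp only [L, coeff_sum, coeff_monomial, Finset.sum_ite_eq', mem_support_iff]
    split_ifs with hm
    · rfl
    · rw [not_not.1 hm, map_zero]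
  have hmul : ∀ a b, L (a * map (algebraMap ℚ K) b) = L a * b := fun a b => by
    classical
    ext m
    simp only [hL, coeff_mul, map_sum, coeff_map]
    refine Finset.sum_congr rfl fun x _ => ?_
    rw [mul_comm, ← Algebra.smul_def, map_smul, smul_eq_mul, mul_comm]
  refine ⟨fun i => L (c i), ?_⟩
  have h1 := congrArg L h
  have hf : L (map (algebraMap ℚ K) f) = f := by
    ext m
    rw [hL, coeff_map]
    exact LinearMap.congr_fun hl _
  rw [hf] at h1
  simp only [← hmul]
  rw [h1]
  ext m
  simp only [hL, coeff_sum, map_sum]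

lemma prod_levelMinor_pow_notMem {K : Type} [Field K] [CharZero K] {q s : ℕ} (hs : 1 ≤ s) (a : ℕ)
    {Y : Matrix (Fin (s + q)) (Fin s) (MvPolynomial (Fin (s + q) × Fin s) K)}
    (hY : ∀ i j, Y i j = X (i, j)) :
    (∏ i ∈ Finset.range (s * q + 1), levelMinor Y i) ^ a ∉
      Ideal.span ((fun i => levelMinor Y i ^ (a + 1)) '' Set.Iio (s * q + 1)) := by
  intro h
  have hθ : ∀ i, levelMinor Y i = map (algebraMap ℚ K)
      (levelMinor (Matrix.of fun i j => X (i, j)) i) := fun i => by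
    rw [map_levelMinor]
    congr 1
    ext1 i j
    simp [hY]
  have hset : (fun i => levelMinor Y i ^ (a + 1)) '' Set.Iio (s * q + 1) =
      Set.range fun i : Fin (s * q + 1) => levelMinor Y i ^ (a + 1) := by
    ext x
    exact ⟨fun ⟨i, hi, hx⟩ => ⟨⟨i, hi⟩, hx⟩, fun ⟨i, hx⟩ => ⟨i, i.2, hx⟩⟩
  rw [hset, Ideal.mem_span_range_iff_exists_fun] at h
  obtain ⟨c, hc⟩ := h
  rw [Finset.prod_range] at hc
  simp only [hθ, ← map_pow, ← map_prod] at hc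
  obtain ⟨c', hc'⟩ := exists_rat_coefficients _ _ _ hc.symm
  exact levelMinor_relation_ne hs a c' hc'

variable (K : Type*) [Field K] (r p s : ℕ)

/-- Substitution of the block diagonal matrix with an identity block and a generic block for the
generic matrix. -/
def blockSpecialization : MvPolynomial (Fin (r + p) × Fin (r + s)) K →ₐ[K]
    MvPolynomial (Fin p × Fin s) K :=
  aeval fun v => Matrix.fromBlocks (1 : Matrix (Fin r) (Fin r) (MvPolynomial (Fin p × Fin s) K))
    0 0 (Matrix.of fun i j => X (i, j)) (finSumFinEquiv.symm v.1) (finSumFinEquiv.symm v.2)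

variable {K r p s} {X : Matrix (Fin (r + p)) (Fin (r + s))
    (MvPolynomial (Fin (r + p) × Fin (r + s)) K)}

lemma blockSpecialization_cornerBlock (hX : ∀ i j, X i j = MvPolynomial.X (i, j)) :
    blockSpecialization K r p s (cornerBlock X).det = 1 := by
  rw [AlgHom.map_det, ← Matrix.det_one (n := Fin r)]
  congr 1
  ext1 i j
  simp [cornerBlock, hX, blockSpecialization]

lemma blockSpecialization_scaledSchur (hX : ∀ i j, X i j = MvPolynomial.X (i, j)) (i : Fin p)
    (j : Fin s) : blockSpecialization K r p s (scaledSchur X i j) = MvPolynomial.X (i, j) := by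
  have h0 : ∀ k, blockSpecialization K r p s (X (Fin.natAdd r i) (Fin.castAdd s k)) = 0 :=
    fun k => by simp [hX, blockSpecialization]
  rw [scaledSchur, Matrix.sub_apply, Matrix.smul_apply, map_sub, smul_eq_mul, map_mul,
    blockSpecialization_cornerBlock hX, Matrix.mul_assoc, Matrix.mul_apply, map_sum,
    Finset.sum_eq_zero]
  · simp [hX, blockSpecialization]
  · intro k _
    rw [map_mul, Matrix.submatrix_apply, h0, zero_mul]

end

section

lemma span_det_cornerBlock_mul_le {S : Type*} [CommRing S] {r q s : ℕ}
    {X : Matrix (Fin (r + (s + q))) (Fin (r + s)) S} {I : Ideal S}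
    (hI : I = Ideal.span {p | ∃ g : Fin (r + s) → Fin (r + (s + q)), StrictMono g ∧
      p = (X.submatrix g id).det}) :
    Ideal.span {(cornerBlock X).det} * I ≤
      (Ideal.span (levelMinor (scaledSchur X) '' Set.Iio (s * q + 1))).radical := by
  set J := Ideal.span (levelMinor (scaledSchur X) '' Set.Iio (s * q + 1))
  have hJ : ∀ g : Fin s → Fin (s + q), ((scaledSchur X).submatrix g id).det ∈ J.radical :=
    det_submatrix_mem_of_orderEmb fun g => by
      have := det_mem_radical_levelMinor (scaledSchur X) g
      rwa [Nat.add_sub_cancel_left] at this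
  rw [Ideal.span_singleton_mul_le_iff]
  intro z hz
  rw [hI] at hz
  induction hz using Submodule.span_induction with
  | mem x hx =>
    obtain ⟨g, -, rfl⟩ := hx
    refine J.radical_isRadical ⟨r - 1 + s + 1, ?_⟩
    have h := det_mul_pow_mem X hJ g
    rw [mul_pow, pow_succ, pow_succ' (X.submatrix g id).det]
    have := J.radical.mul_mem_right ((cornerBlock X).det * (X.submatrix g id).det ^ (r - 1 + s)) h
    convert this using 1
    ring
  | zero => rw [mul_zero]; exact zero_mem _
  | add x y _ _ hx hy => rw [mul_add]; exact add_mem hx hy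
  | smul a x _ hx => rw [smul_eq_mul, mul_left_comm]; exact Ideal.mul_mem_left _ _ hx

lemma nontrivial_localCohomology_maximal_minors (K : Type) [Field K] [CharZero K] (r q s : ℕ)
    (hs : 1 ≤ s)
    (X : Matrix (Fin (r + (s + q))) (Fin (r + s))
      (MvPolynomial (Fin (r + (s + q)) × Fin (r + s)) K))
    (hX : ∀ i j, X i j = MvPolynomial.X (i, j))
    (I : Ideal (MvPolynomial (Fin (r + (s + q)) × Fin (r + s)) K))
    (hI : I = Ideal.span {p | ∃ g : Fin (r + s) → Fin (r + (s + q)), StrictMono g ∧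
      p = (X.submatrix g id).det}) :
    Nontrivial ((localCohomology I (s * q + 1)).obj
      (ModuleCat.of (MvPolynomial (Fin (r + (s + q)) × Fin (r + s)) K)
        (MvPolynomial (Fin (r + (s + q)) × Fin (r + s)) K))) := by
  rw [← not_subsingleton_iff_nontrivial]
  intro hsub
  have hδ : (cornerBlock X).det ≠ 0 := fun h => by
    simpa [h] using blockSpecialization_cornerBlock hX
  have hminor : ∀ g : Fin (r + s) → Fin (r + (s + q)), (X.submatrix g id).det ∈ I :=
    det_submatrix_mem_of_orderEmb fun g => hI ▸ Ideal.subset_span ⟨g, g.strictMono, rfl⟩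
  have hθ : ∀ i < s * q + 1, levelMinor (scaledSchur X) i ∈ I := fun i _ =>
    levelMinor_mem (fun g => det_scaledSchur_mem X hs hδ hminor g) i
  obtain ⟨a, N, h⟩ := exists_mem_span_pow_of_subsingleton_localCohomology I (s * q) hsub
    (levelMinor (scaledSchur X)) hθ _ (span_det_cornerBlock_mul_le hI)
  refine prod_levelMinor_pow_notMem (K := K) (Y := (scaledSchur X).map
    (blockSpecialization K r (s + q) s)) hs a (blockSpecialization_scaledSchur hX) ?_
  have hmap : ∀ i, blockSpecialization K r (s + q) s (levelMinor (scaledSchur X) i) =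
      levelMinor ((scaledSchur X).map (blockSpecialization K r (s + q) s)) i :=
    map_levelMinor (blockSpecialization K r (s + q) s).toRingHom (scaledSchur X)
  have h1 := Ideal.mem_map_of_mem (blockSpecialization K r (s + q) s) h
  rw [Ideal.map_span, map_mul, map_pow _ _ N, blockSpecialization_cornerBlock hX, one_pow,
    mul_one, map_pow, map_prod, ← Set.image_comp] at h1
  simpa only [Function.comp_def, map_pow, hmap] using h1

end

end

/-- The local cohomology modules of the polynomial ring `S` in the entries of the
generic `m × n` matrix, with support in the ideal of maximal minors, are nonzero in
all cohomological degrees of the form `s * (m - n) + 1` for `1 ≤ s ≤ n`. -/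
theorem local_cohomology_maximal_minors_nonvanishing
    (K : Type) [Field K] [CharZero K] (m n : ℕ) (hn : 1 ≤ n) (hmn : n < m)
    (X : Matrix (Fin m) (Fin n) (MvPolynomial (Fin m × Fin n) K))
    (hX : ∀ i j, X i j = MvPolynomial.X (i, j))
    (I : Ideal (MvPolynomial (Fin m × Fin n) K))
    (hI : I = Ideal.span {p | ∃ g : Fin n → Fin m, StrictMono g ∧
      p = (X.submatrix g id).det})
    (s : ℕ) (hs1 : 1 ≤ s) (hsn : s ≤ n) :
    Nontrivial ((localCohomology I (s * (m - n) + 1)).obj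
      (ModuleCat.of (MvPolynomial (Fin m × Fin n) K) (MvPolynomial (Fin m × Fin n) K))) := by
  obtain ⟨r, rfl⟩ := Nat.exists_eq_add_of_le' hsn
  obtain ⟨q, hq⟩ := Nat.exists_eq_add_of_le hmn.le
  obtain rfl : m = r + (s + q) := by omega
  have hm : r + (s + q) - (r + s) = q := by omega
  rw [hm]
  exact nontrivial_localCohomology_maximal_minors K r q s hs1 X hX I hI
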